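/- arXiv:2506.01739 — 5 statements merged into one kernel-verified Lean document; each statement's English description precedes it below -/
import Mathlib

section
/- There exist constants c > 0 and C > 0 such that, for infinitely many positive integers m, there exists a 3-graph F satisfying: (a) F contains no (6,4)-configuration and no (10,8)-configuration; (b) for every k ∈ {2,…,7}, F contains no (k+1,k)-configuration; (c) |E(F)| ≥ c·m^{3/2}·log m; (d) (8/3)·|E(F)| ≤ |P_{≤4}(F)| ≤ (8/3)·|E(F)| + C·m^{3/2}. -/
open scoped Classical

/-- An `(s,k)`-configuration in a hypergraph `F`: `k` distinct edges whose union has at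
most `s` vertices. -/
def HasConfig {V : Type} (F : Finset (Finset V)) (s k : ℕ) : Prop :=
  ∃ S ⊆ F, S.card = k ∧ (S.sup id).card ≤ s

/-- The set of pairs of distinct vertices that are `i`-claimed by the 3-graph `F`
for some `1 ≤ i ≤ 4`: pairs `{x,y}` for which there are `i` distinct edges
`X₁,…,Xᵢ` with `|{x,y} ∪ X₁ ∪ ⋯ ∪ Xᵢ| ≤ i + 2`. -/
def PleFour {V : Type} (F : Finset (Finset V)) : Set (Finset V) :=
  {p : Finset V | p.card = 2 ∧
    ∃ i : ℕ, 1 ≤ i ∧ i ≤ 4 ∧ ∃ S ⊆ F, S.card = i ∧ (p ∪ S.sup id).card ≤ i + 2}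

namespace BESConstr

theorem cfg {V : Type} {F : Finset (Finset V)} {s k : ℕ} (h : HasConfig F s k) :
    ∃ S ⊆ F, S.card = k ∧ ∃ U : Finset V, (∀ e ∈ S, e ⊆ U) ∧ U.card ≤ s := by
  obtain ⟨S, hS, hk, hs⟩ := h
  exact ⟨S, hS, hk, S.sup id, fun e he => Finset.le_sup (f := id) he, hs⟩

theorem ple_out {V : Type} {F : Finset (Finset V)} {p : Finset V} (h : p ∈ PleFour F) :
    p.card = 2 ∧ ∃ i : ℕ, 1 ≤ i ∧ i ≤ 4 ∧ ∃ S ⊆ F, S.card = i ∧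
      ∃ W : Finset V, p ⊆ W ∧ (∀ e ∈ S, e ⊆ W) ∧ W.card ≤ i + 2 := by
  obtain ⟨hp, i, hi, hi4, S, hS, hSc, hc⟩ := h
  exact ⟨hp, i, hi, hi4, S, hS, hSc, p ∪ S.sup id, Finset.subset_union_left,
    fun e he => (Finset.le_sup (f := id) he : e ⊆ S.sup id).trans Finset.subset_union_right, hc⟩

theorem ple_in {V : Type} {F : Finset (Finset V)} {p e : Finset V} (he : e ∈ F) (hp : p ⊆ e)
    (h2 : p.card = 2) (h3 : e.card = 3) : p ∈ PleFour F := by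
  refine ⟨h2, 1, le_rfl, by norm_num, {e}, by simpa using he, by simp, ?_⟩
  have : p ∪ ({e} : Finset (Finset V)).sup id ⊆ e := Finset.union_subset hp (by simp)
  exact (Finset.card_le_card this).trans h3.le

theorem sup_facts {V : Type} (S : Finset (Finset V)) :
    ∃ U : Finset V, (∀ e ∈ S, e ⊆ U) ∧ ∀ W : Finset V, (∀ e ∈ S, e ⊆ W) → U ⊆ W :=
  ⟨S.sup id, fun _ he => Finset.le_sup (f := id) he, fun _ hW => Finset.sup_le hW⟩

/-- Vertices: `X v`, `Y v` for `v` in the grid, row vertices `A i`, column vertices `B j`, and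
one apex `Z`. -/
abbrev Vt (n : ℕ) : Type :=
  (Fin n × Fin n) ⊕ ((Fin n × Fin n) ⊕ (Fin n ⊕ (Fin n ⊕ Unit)))

abbrev vX {n : ℕ} (v : Fin n × Fin n) : Vt n := Sum.inl v
abbrev vY {n : ℕ} (v : Fin n × Fin n) : Vt n := Sum.inr (Sum.inl v)
abbrev vA {n : ℕ} (i : Fin n) : Vt n := Sum.inr (Sum.inr (Sum.inl i))
abbrev vB {n : ℕ} (i : Fin n) : Vt n := Sum.inr (Sum.inr (Sum.inr (Sum.inl i)))
abbrev vZ {n : ℕ} : Vt n := Sum.inr (Sum.inr (Sum.inr (Sum.inr ())))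

def e0 {n : ℕ} (v : Fin n × Fin n) : Finset (Vt n) := {vX v, vY v, vZ}
def e1 {n : ℕ} (v : Fin n × Fin n) : Finset (Vt n) := {vX v, vA v.1, vB v.2}
def e2 {n : ℕ} (v : Fin n × Fin n) : Finset (Vt n) := {vY v, vA v.1, vB v.2}

def FF (n : ℕ) : Finset (Finset (Vt n)) :=
  (Finset.univ.image e0 ∪ Finset.univ.image e1) ∪ Finset.univ.image e2

theorem e0_inj {n : ℕ} : Function.Injective (e0 (n := n)) := by
  intro v w h
  have : vX v ∈ e0 w := by rw [← h]; simp [e0]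
  simpa [e0] using this

theorem e1_inj {n : ℕ} : Function.Injective (e1 (n := n)) := by
  intro v w h
  have : vX v ∈ e1 w := by rw [← h]; simp [e1]
  simpa [e1] using this

theorem e2_inj {n : ℕ} : Function.Injective (e2 (n := n)) := by
  intro v w h
  have : vY v ∈ e2 w := by rw [← h]; simp [e2]
  simpa [e2] using this

theorem e01 {n : ℕ} (v w : Fin n × Fin n) : e0 v ≠ e1 w := by
  intro h
  have : vZ ∈ e1 w := by rw [← h]; simp [e0]
  simp [e1] at this

theorem e02 {n : ℕ} (v w : Fin n × Fin n) : e0 v ≠ e2 w := by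
  intro h
  have : vZ ∈ e2 w := by rw [← h]; simp [e0]
  simp [e2] at this

theorem e12 {n : ℕ} (v w : Fin n × Fin n) : e1 v ≠ e2 w := by
  intro h
  have : vX v ∈ e2 w := by rw [← h]; simp [e1]
  simp [e2] at this

theorem mem_FF {n : ℕ} (e : Finset (Vt n)) :
    e ∈ FF n ↔ (∃ v, e = e0 v) ∨ (∃ v, e = e1 v) ∨ (∃ v, e = e2 v) := by
  simp only [FF, Finset.mem_union, Finset.mem_image, Finset.mem_univ, true_and, eq_comm, or_assoc]

theorem card_three {n : ℕ} (P0 P1 P2 : Finset (Fin n × Fin n)) :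
    ((P0.image e0 ∪ P1.image e1) ∪ P2.image e2).card = P0.card + P1.card + P2.card := by
  rw [Finset.card_union_of_disjoint, Finset.card_union_of_disjoint,
    Finset.card_image_of_injective _ e0_inj, Finset.card_image_of_injective _ e1_inj,
    Finset.card_image_of_injective _ e2_inj]
  · rw [Finset.disjoint_left]
    intro e h1 h2
    obtain ⟨v, -, rfl⟩ := Finset.mem_image.1 h1
    obtain ⟨w, -, hw⟩ := Finset.mem_image.1 h2
    exact e01 _ _ hw.symm
  · rw [Finset.disjoint_left]
    intro e h1 h2
    obtain ⟨w, -, hw⟩ := Finset.mem_image.1 h2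
    rcases Finset.mem_union.1 h1 with h1 | h1
    · obtain ⟨v, -, rfl⟩ := Finset.mem_image.1 h1
      exact e02 _ _ hw.symm
    · obtain ⟨v, -, rfl⟩ := Finset.mem_image.1 h1
      exact e12 _ _ hw.symm

theorem FF_card (n : ℕ) : (FF n).card = 3 * n ^ 2 := by
  rw [FF, card_three]
  simp
  ring

theorem FF_three {n : ℕ} : ∀ e ∈ FF n, e.card = 3 := by
  intro e he
  rcases (mem_FF e).1 he with ⟨v, rfl⟩ | ⟨v, rfl⟩ | ⟨v, rfl⟩ <;>
    simp [e0, e1, e2, Finset.card_insert_of_notMem]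

/-- The counting data attached to a set of edges. -/
theorem key {n : ℕ} (S : Finset (Finset (Vt n))) (hS : S ⊆ FF n) (U : Finset (Vt n))
    (hU : ∀ e ∈ S, e ⊆ U) :
    ∃ (E : Finset (Fin n × Fin n)) (p0 p1 p2 d q t r c z : ℕ),
      (∀ e ∈ S, ∃ v ∈ E, e = e0 v ∨ e = e1 v ∨ e = e2 v) ∧ E.card = d + q ∧
      S.card = p0 + p1 + p2 ∧ S.card + q + r + c + z ≤ U.card + t ∧
      d ≤ r * c ∧ p0 ≤ q + d ∧ q ≤ p0 ∧ p1 ≤ d ∧ p2 ≤ d ∧ t ≤ p0 ∧ t ≤ p1 ∧ t ≤ p2 ∧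
      (0 < p0 → 0 < z) := by
  let P0 : Finset (Fin n × Fin n) := Finset.univ.filter (fun v => e0 v ∈ S)
  let P1 : Finset (Fin n × Fin n) := Finset.univ.filter (fun v => e1 v ∈ S)
  let P2 : Finset (Fin n × Fin n) := Finset.univ.filter (fun v => e2 v ∈ S)
  have m0 : ∀ v, v ∈ P0 ↔ e0 v ∈ S := by simp [P0]
  have m1 : ∀ v, v ∈ P1 ↔ e1 v ∈ S := by simp [P1]
  have m2 : ∀ v, v ∈ P2 ↔ e2 v ∈ S := by simp [P2]
  clear_value P0 P1 P2
  have hSeq : S = (P0.image e0 ∪ P1.image e1) ∪ P2.image e2 := by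
    ext e
    simp only [Finset.mem_union, Finset.mem_image, m0, m1, m2]
    constructor
    · intro he
      rcases (mem_FF e).1 (hS he) with ⟨v, rfl⟩ | ⟨v, rfl⟩ | ⟨v, rfl⟩
      · exact Or.inl (Or.inl ⟨v, he, rfl⟩)
      · exact Or.inl (Or.inr ⟨v, he, rfl⟩)
      · exact Or.inr ⟨v, he, rfl⟩
    · rintro ((⟨v, h, rfl⟩ | ⟨v, h, rfl⟩) | ⟨v, h, rfl⟩) <;> exact h
  have hcard : S.card = P0.card + P1.card + P2.card := by
    rw [hSeq]; exact card_three _ _ _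
  let D := P1 ∪ P2
  have hsub : Finset.disjSum (P0 ∪ P1) (Finset.disjSum (P0 ∪ P2) (Finset.disjSum (D.image Prod.fst)
      (Finset.disjSum (D.image Prod.snd) (P0.image (fun _ => ()))))) ⊆ U := by
    intro x hx
    have a0 : ∀ v, e0 v ∈ S → vX v ∈ U ∧ vY v ∈ U ∧ vZ ∈ U := fun v hv =>
      ⟨hU _ hv (by simp [e0]), hU _ hv (by simp [e0]), hU _ hv (by simp [e0])⟩
    have a1 : ∀ v, e1 v ∈ S → vX v ∈ U ∧ vA v.1 ∈ U ∧ vB v.2 ∈ U := fun v hv =>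
      ⟨hU _ hv (by simp [e1]), hU _ hv (by simp [e1]), hU _ hv (by simp [e1])⟩
    have a2 : ∀ v, e2 v ∈ S → vY v ∈ U ∧ vA v.1 ∈ U ∧ vB v.2 ∈ U := fun v hv =>
      ⟨hU _ hv (by simp [e2]), hU _ hv (by simp [e2]), hU _ hv (by simp [e2])⟩
    rcases x with v | v | i | j | u
    · simp only [Finset.inl_mem_disjSum, Finset.mem_union, m0, m1] at hx
      rcases hx with h | h
      · exact (a0 _ h).1
      · exact (a1 _ h).1
    · simp only [Finset.inl_mem_disjSum, Finset.inr_mem_disjSum, Finset.mem_union, m0, m2] at hx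
      rcases hx with h | h
      · exact (a0 _ h).2.1
      · exact (a2 _ h).1
    · simp only [Finset.inl_mem_disjSum, Finset.inr_mem_disjSum, Finset.mem_image, D,
        Finset.mem_union, m1, m2] at hx
      obtain ⟨v, h | h, rfl⟩ := hx
      · exact (a1 _ h).2.1
      · exact (a2 _ h).2.1
    · simp only [Finset.inl_mem_disjSum, Finset.inr_mem_disjSum, Finset.mem_image, D,
        Finset.mem_union, m1, m2] at hx
      obtain ⟨v, h | h, rfl⟩ := hx
      · exact (a1 _ h).2.2
      · exact (a2 _ h).2.2
    · simp only [Finset.inr_mem_disjSum, Finset.mem_image, m0] at hx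
      obtain ⟨v, h, -⟩ := hx
      exact (a0 _ h).2.2
  have hle := Finset.card_le_card hsub
  simp only [Finset.card_disjSum] at hle
  refine ⟨D ∪ (P0 \ D), P0.card, P1.card, P2.card, D.card, (P0 \ D).card, (P0 ∩ P1 ∩ P2).card,
    (D.image Prod.fst).card, (D.image Prod.snd).card, (P0.image (fun _ => ())).card,
    ?_, ?_, hcard, ?_, ?_, ?_, ?_, ?_, ?_, ?_, ?_, ?_, ?_⟩
  · intro e he
    rcases (mem_FF e).1 (hS he) with ⟨v, rfl⟩ | ⟨v, rfl⟩ | ⟨v, rfl⟩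
    · refine ⟨v, ?_, by simp⟩
      have := (m0 v).2 he
      simp only [Finset.mem_union, Finset.mem_sdiff]; tauto
    · refine ⟨v, ?_, by simp⟩
      have := (m1 v).2 he
      simp only [Finset.mem_union, D]; tauto
    · refine ⟨v, ?_, by simp⟩
      have := (m2 v).2 he
      simp only [Finset.mem_union, D]; tauto
  · rw [Finset.card_union_of_disjoint Finset.disjoint_sdiff]
  · have h1 := Finset.card_union_add_card_inter P0 P1
    have h2 := Finset.card_union_add_card_inter P0 P2
    have h3 := Finset.card_union_add_card_inter (P0 ∩ P1) (P0 ∩ P2)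
    have h4 : (P0 ∩ P1) ∪ (P0 ∩ P2) = P0 ∩ D := by
      ext v; simp only [D, Finset.mem_union, Finset.mem_inter]; tauto
    have h5 : (P0 ∩ P1) ∩ (P0 ∩ P2) = P0 ∩ P1 ∩ P2 := by
      ext v; simp only [Finset.mem_inter]; tauto
    rw [h4, h5] at h3
    have h6 := Finset.card_sdiff_add_card_inter P0 D
    omega
  · rw [← Finset.card_product]
    apply Finset.card_le_card
    intro v hv
    simp only [Finset.mem_product]
    exact ⟨Finset.mem_image_of_mem _ hv, Finset.mem_image_of_mem _ hv⟩
  · have h6 := Finset.card_sdiff_add_card_inter P0 D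
    have := Finset.card_le_card (Finset.inter_subset_right (s₁ := P0) (s₂ := D))
    omega
  · exact Finset.card_le_card Finset.sdiff_subset
  · exact Finset.card_le_card Finset.subset_union_left
  · exact Finset.card_le_card Finset.subset_union_right
  · apply Finset.card_le_card
    intro v; simp only [Finset.mem_inter]; tauto
  · apply Finset.card_le_card
    intro v; simp only [Finset.mem_inter]; tauto
  · apply Finset.card_le_card
    intro v; simp only [Finset.mem_inter]; tauto
  · intro h
    rw [Finset.card_pos] at h ⊢
    exact h.image _

theorem rc_facts {d r c : ℕ} (h : d ≤ r * c) :
    (0 < d → 0 < r ∧ 0 < c) ∧ (r + c ≤ 2 → d ≤ 1) ∧ (r + c ≤ 3 → d ≤ 2) := by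
  refine ⟨fun hd => ⟨?_, ?_⟩, fun h2 => ?_, fun h2 => ?_⟩
  · rcases Nat.eq_zero_or_pos r with rfl | h0
    · simp at h; omega
    · exact h0
  · rcases Nat.eq_zero_or_pos c with rfl | h0
    · simp at h; omega
    · exact h0
  · have hr : r ≤ 2 := by omega
    have hc : c ≤ 2 := by omega
    interval_cases r <;> interval_cases c <;> omega
  · have hr : r ≤ 3 := by omega
    have hc : c ≤ 3 := by omega
    interval_cases r <;> interval_cases c <;> omega

theorem no_conf {n k s : ℕ} (hks : (k = 4 ∧ s = 6) ∨ (k = 8 ∧ s = 10) ∨ (2 ≤ k ∧ k ≤ 7 ∧ s = k + 1)) :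
    ¬ HasConfig (FF n) s k := by
  intro hconf
  obtain ⟨S, hS, hk, U, hU, hs⟩ := cfg hconf
  obtain ⟨E, p0, p1, p2, d, q, t, r, c, z, -, -, h1, h2, h3, h4, h5, h6, h7, h8, h9, h10, h11⟩ :=
    key S hS U hU
  obtain ⟨f1, f2, f3⟩ := rc_facts h3
  omega

set_option maxHeartbeats 1000000 in
theorem claim_struct {n k : ℕ} (S : Finset (Finset (Vt n))) (hS : S ⊆ FF n) (hk : S.card = k)
    (h1k : 1 ≤ k) (hk4 : k ≤ 4) (W : Finset (Vt n)) (hW : ∀ e ∈ S, e ⊆ W)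
    (hc : W.card ≤ k + 2) : ∃ v, W ⊆ {vX v, vY v, vA v.1, vB v.2, vZ} := by
  have aux : ∀ U : Finset (Vt n), (∀ e ∈ S, e ⊆ U) → k + 2 ≤ U.card := by
    intro U hU
    obtain ⟨E, p0, p1, p2, d, q, t, r, c, z, -, -, h1, h2, h3, h4, h5, h6, h7, h8, h9, h10, h11⟩ :=
      key S hS U hU
    obtain ⟨f1, f2, f3⟩ := rc_facts h3
    omega
  obtain ⟨E, p0, p1, p2, d, q, t, r, c, z, hE, hEc, h1, h2, h3, h4, h5, h6, h7, h8, h9, h10, h11⟩ :=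
    key S hS W hW
  obtain ⟨f1, f2, f3⟩ := rc_facts h3
  have hE1 : E.card ≤ 1 := by omega
  have hSne : S.Nonempty := by rw [← Finset.card_pos]; omega
  obtain ⟨e, he⟩ := hSne
  obtain ⟨v, hv, -⟩ := hE e he
  refine ⟨v, ?_⟩
  have hE' : ∀ w ∈ E, w = v := fun w hw => Finset.card_le_one.1 hE1 w hw v hv
  obtain ⟨U, hU, hmin⟩ := sup_facts S
  have hEq : U = W := Finset.eq_of_subset_of_card_le (hmin W hW) (hc.trans (aux _ hU))
  rw [← hEq]
  apply hmin
  intro e he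
  obtain ⟨w, hw, h⟩ := hE e he
  obtain rfl := hE' w hw
  intro x hx
  rcases h with rfl | rfl | rfl
  · simp only [e0, Finset.mem_insert, Finset.mem_singleton] at hx
    rcases hx with h | h | h <;> simp [h]
  · simp only [e1, Finset.mem_insert, Finset.mem_singleton] at hx
    rcases hx with h | h | h <;> simp [h]
  · simp only [e2, Finset.mem_insert, Finset.mem_singleton] at hx
    rcases hx with h | h | h <;> simp [h]

def gl {n : ℕ} : Fin 8 → (Fin n × Fin n) → Vt n :=
  ![fun v => vA v.1, fun v => vA v.1, fun v => vB v.2, fun v => vA v.1, fun v => vB v.2,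
    fun v => vX v, fun v => vX v, fun v => vY v]
def gr {n : ℕ} : Fin 8 → (Fin n × Fin n) → Vt n :=
  ![fun v => vB v.2, fun v => vX v, fun v => vX v, fun v => vY v, fun v => vY v,
    fun v => vY v, fun _ => vZ, fun _ => vZ]
def gp {n : ℕ} (x : Fin 8 × (Fin n × Fin n)) : Finset (Vt n) := {gl x.1 x.2, gr x.1 x.2}

theorem gp_inj {n : ℕ} : Function.Injective (gp (n := n)) := by
  rintro ⟨l, v⟩ ⟨l', v'⟩ h
  have h' : ({gl l v, gr l v} : Set (Vt n)) = {gl l' v', gr l' v'} := by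
    have := congrArg (fun s : Finset (Vt n) => (s : Set (Vt n))) h
    simpa [gp] using this
  rw [Set.pair_eq_pair_iff] at h'
  obtain ⟨i, j⟩ := v
  obtain ⟨i', j'⟩ := v'
  fin_cases l <;> fin_cases l' <;> simp [gl, gr] at h' ⊢ <;> tauto

theorem gp_mem {n : ℕ} (x : Fin 8 × (Fin n × Fin n)) : gp x ∈ PleFour (FF n) := by
  have main : ∀ (p e : Finset (Vt n)), e ∈ FF n → p ⊆ e → p.card = 2 → p ∈ PleFour (FF n) := by
    intro p e he hp h2
    exact ple_in he hp h2 (FF_three e he)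
  have m0 : ∀ v, e0 v ∈ FF n := fun v => (mem_FF _).2 (Or.inl ⟨v, rfl⟩)
  have m1 : ∀ v, e1 v ∈ FF n := fun v => (mem_FF _).2 (Or.inr (Or.inl ⟨v, rfl⟩))
  have m2 : ∀ v, e2 v ∈ FF n := fun v => (mem_FF _).2 (Or.inr (Or.inr ⟨v, rfl⟩))
  obtain ⟨l, v⟩ := x
  have hc : (gp (l, v)).card = 2 := by
    apply Finset.card_pair
    fin_cases l <;> simp [gl, gr]
  fin_cases l
  · exact main _ (e1 v) (m1 v) (by intro x; simp [gp, gl, gr, e1]; tauto) hc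
  · exact main _ (e1 v) (m1 v) (by intro x; simp [gp, gl, gr, e1]; tauto) hc
  · exact main _ (e1 v) (m1 v) (by intro x; simp [gp, gl, gr, e1]; tauto) hc
  · exact main _ (e2 v) (m2 v) (by intro x; simp [gp, gl, gr, e2]; tauto) hc
  · exact main _ (e2 v) (m2 v) (by intro x; simp [gp, gl, gr, e2]; tauto) hc
  · exact main _ (e0 v) (m0 v) (by intro x; simp [gp, gl, gr, e0]; tauto) hc
  · exact main _ (e0 v) (m0 v) (by intro x; simp [gp, gl, gr, e0]; tauto) hc
  · exact main _ (e0 v) (m0 v) (by intro x; simp [gp, gl, gr, e0]; tauto) hc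

/-- The list of all possibly claimed pairs. -/
def cand (n : ℕ) : Finset (Finset (Vt n)) :=
  (Finset.univ.image gp ∪ Finset.univ.image (fun i : Fin n => {vA i, vZ})) ∪
    Finset.univ.image (fun i : Fin n => {vB i, vZ})

theorem cand_card (n : ℕ) : (cand n).card ≤ 8 * n ^ 2 + 2 * n := by
  refine (Finset.card_union_le _ _).trans ?_
  have h1 := Finset.card_union_le (Finset.univ.image (gp (n := n)))
    (Finset.univ.image (fun i : Fin n => ({vA i, vZ} : Finset (Vt n))))
  have h2 := Finset.card_image_le (s := Finset.univ) (f := gp (n := n))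
  have h3 := Finset.card_image_le (s := Finset.univ)
    (f := (fun i : Fin n => ({vA i, vZ} : Finset (Vt n))))
  have h4 := Finset.card_image_le (s := Finset.univ)
    (f := (fun i : Fin n => ({vB i, vZ} : Finset (Vt n))))
  simp only [Finset.card_univ, Fintype.card_prod, Fintype.card_fin] at h2 h3 h4
  have : 8 * (n * n) = 8 * n ^ 2 := by ring
  omega

theorem pair_mem_cand {n : ℕ} (v : Fin n × Fin n) (a b : Vt n) (hab : a ≠ b)
    (ha : a = vX v ∨ a = vY v ∨ a = vA v.1 ∨ a = vB v.2 ∨ a = vZ)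
    (hb : b = vX v ∨ b = vY v ∨ b = vA v.1 ∨ b = vB v.2 ∨ b = vZ) :
    ({a, b} : Finset (Vt n)) ∈ cand n := by
  have key1 : ∀ l, ({gl l v, gr l v} : Finset (Vt n)) ∈ cand n := fun l =>
    Finset.mem_union_left _ (Finset.mem_union_left _
      (Finset.mem_image.2 ⟨(l, v), Finset.mem_univ _, rfl⟩))
  have kA : ({vA v.1, vZ} : Finset (Vt n)) ∈ cand n :=
    Finset.mem_union_left _ (Finset.mem_union_right _
      (Finset.mem_image.2 ⟨v.1, Finset.mem_univ _, rfl⟩))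
  have kB : ({vB v.2, vZ} : Finset (Vt n)) ∈ cand n :=
    Finset.mem_union_right _ (Finset.mem_image.2 ⟨v.2, Finset.mem_univ _, rfl⟩)
  have k0 : ({vA v.1, vB v.2} : Finset (Vt n)) ∈ cand n := key1 0
  have k1 : ({vA v.1, vX v} : Finset (Vt n)) ∈ cand n := key1 1
  have k2 : ({vB v.2, vX v} : Finset (Vt n)) ∈ cand n := key1 2
  have k3 : ({vA v.1, vY v} : Finset (Vt n)) ∈ cand n := key1 3
  have k4 : ({vB v.2, vY v} : Finset (Vt n)) ∈ cand n := key1 4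
  have k5 : ({vX v, vY v} : Finset (Vt n)) ∈ cand n := key1 5
  have k6 : ({vX v, vZ} : Finset (Vt n)) ∈ cand n := key1 6
  have k7 : ({vY v, vZ} : Finset (Vt n)) ∈ cand n := key1 7
  rcases ha with rfl | rfl | rfl | rfl | rfl <;> rcases hb with rfl | rfl | rfl | rfl | rfl <;>
    first
    | exact absurd rfl hab
    | assumption
    | (rw [Finset.pair_comm]; assumption)

theorem Ple_sub {n : ℕ} : PleFour (FF n) ⊆ (cand n : Set (Finset (Vt n))) := by
  intro p hp'
  obtain ⟨hp, i, hi, hi4, S, hS, hSc, W, hpW, hW, hc⟩ := ple_out hp'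
  obtain ⟨v, hv⟩ := claim_struct S hS hSc hi hi4 W hW hc
  obtain ⟨a, b, hab, rfl⟩ := Finset.card_eq_two.1 hp
  have ha := hv (hpW (Finset.mem_insert_self a {b}))
  have hb := hv (hpW
    (Finset.mem_insert_of_mem (Finset.mem_singleton_self b)))
  simp only [Finset.mem_insert, Finset.mem_singleton] at ha hb
  exact pair_mem_cand v a b hab ha hb

theorem Ple_upper (n : ℕ) : (PleFour (FF n)).ncard ≤ 8 * n ^ 2 + 2 * n := by
  refine (Set.ncard_le_ncard Ple_sub (Finset.finite_toSet _)).trans ?_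
  rw [Set.ncard_coe_finset]
  exact cand_card n

theorem Ple_lower (n : ℕ) : 8 * n ^ 2 ≤ (PleFour (FF n)).ncard := by
  have h : ((Finset.univ.image (gp (n := n)) : Finset _) : Set (Finset (Vt n))) ⊆ PleFour (FF n) := by
    intro p hp
    obtain ⟨x, -, rfl⟩ := Finset.mem_image.1 (Finset.mem_coe.1 hp)
    exact gp_mem x
  have h2 := Set.ncard_le_ncard h ((Finset.finite_toSet _).subset Ple_sub)
  rw [Set.ncard_coe_finset, Finset.card_image_of_injective _ gp_inj] at h2
  simp only [Finset.card_univ, Fintype.card_prod, Fintype.card_fin] at h2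
  have : 8 * (n * n) = 8 * n ^ 2 := by ring
  omega

end BESConstr

/-- There are constants `c, C > 0` such that for infinitely many positive integers `m`
there is a 3-graph `F` with: (a) no `(6,4)`- and no `(10,8)`-configuration; (b) no
`(k+1,k)`-configuration for `2 ≤ k ≤ 7`; (c) `|F| ≥ c·m^{3/2}·log m`; and (d)
`(8/3)|F| ≤ |P_{≤4}(F)| ≤ (8/3)|F| + C·m^{3/2}`. -/
theorem construction_F_exists :
    ∃ c : ℝ, 0 < c ∧ ∃ C : ℝ, 0 < C ∧
      {m : ℕ | 0 < m ∧ ∃ (V : Type) (F : Finset (Finset V)),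
        (∀ e ∈ F, e.card = 3) ∧
        -- (a)
        ¬ HasConfig F 6 4 ∧ ¬ HasConfig F 10 8 ∧
        -- (b)
        (∀ k : ℕ, 2 ≤ k → k ≤ 7 → ¬ HasConfig F (k + 1) k) ∧
        -- (c)
        c * (m : ℝ) ^ ((3 : ℝ) / 2) * Real.log (m : ℝ) ≤ (F.card : ℝ) ∧
        -- (d)
        (8 : ℝ) / 3 * (F.card : ℝ) ≤ ((PleFour F).ncard : ℝ) ∧
        ((PleFour F).ncard : ℝ) ≤ (8 : ℝ) / 3 * (F.card : ℝ) + C * (m : ℝ) ^ ((3 : ℝ) / 2)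
        }.Infinite := by
  refine ⟨1, one_pos, 2, two_pos, ?_⟩
  refine (Set.infinite_of_injective_forall_mem (f := fun m : ℕ => m + 1)
    (fun a b h => by simpa using h) ?_)
  intro m0
  generalize hm : m0 + 1 = m
  have hm1 : 1 ≤ m := by omega
  have hmR : (1 : ℝ) ≤ (m : ℝ) := by exact_mod_cast hm1
  refine ⟨by omega, BESConstr.Vt m, BESConstr.FF m, BESConstr.FF_three,
    BESConstr.no_conf (by omega), BESConstr.no_conf (by omega),
    fun k h2 h7 => BESConstr.no_conf (by omega), ?_, ?_, ?_⟩
  · rw [BESConstr.FF_card]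
    have hlog : Real.log (m : ℝ) ≤ (m : ℝ) ^ ((1 : ℝ) / 2) / (1 / 2) :=
      Real.log_le_rpow_div (by positivity) (by norm_num)
    have hpow : (m : ℝ) ^ ((3 : ℝ) / 2) * (m : ℝ) ^ ((1 : ℝ) / 2) = (m : ℝ) ^ 2 := by
      rw [← Real.rpow_add (by linarith)]
      norm_num
    have hnn : (0 : ℝ) ≤ (m : ℝ) ^ ((3 : ℝ) / 2) := by positivity
    have := mul_le_mul_of_nonneg_left hlog hnn
    push_cast
    nlinarith [sq_nonneg (m : ℝ)]
  · rw [BESConstr.FF_card]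
    have h : ((8 * m ^ 2 : ℕ) : ℝ) ≤ _ := Nat.cast_le.2 (BESConstr.Ple_lower m)
    push_cast at h ⊢
    linarith
  · rw [BESConstr.FF_card]
    have h : _ ≤ ((8 * m ^ 2 + 2 * m : ℕ) : ℝ) := Nat.cast_le.2 (BESConstr.Ple_upper m)
    have h2 : (m : ℝ) ≤ (m : ℝ) ^ ((3 : ℝ) / 2) := by
      calc (m : ℝ) = (m : ℝ) ^ (1 : ℝ) := (Real.rpow_one _).symm
        _ ≤ _ := Real.rpow_le_rpow_of_exponent_le hmR (by norm_num)
    push_cast at h ⊢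
    linarith
end

section
/- Let H be a graph and P_1,…,P_N distinct 2-paths of H, where P_i has internal vertex a_i and endpoints u_i, v_i. Assume that for every j ∈ {1,…,8}, the union of the vertex sets of any j distinct paths among P_1,…,P_N has at least j+2 elements. Let F be the associated 3-graph built from P_1,…,P_N. Then F has exactly 3N edges and, for every k ∈ {2,…,8}, the union of any k distinct edges of F contains at least k+2 vertices. -/
open scoped Classical

/-- Vertex type of the associated 3-graph: the original vertices plus, for each index
`i`, two new vertices `bᵢ = inr (i, false)` and `cᵢ = inr (i, true)`. -/
abbrev AssocVert (V : Type) (N : ℕ) : Type := V ⊕ (Fin N × Bool)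

/-- The block `Rᵢ = {{aᵢ,bᵢ,cᵢ}, {bᵢ,uᵢ,vᵢ}, {cᵢ,uᵢ,vᵢ}}` of the associated 3-graph. -/
noncomputable def block {V : Type} {N : ℕ} (a u v : Fin N → V) (i : Fin N) :
    Finset (Finset (AssocVert V N)) :=
  { {Sum.inl (a i), Sum.inr (i, false), Sum.inr (i, true)},
    {Sum.inr (i, false), Sum.inl (u i), Sum.inl (v i)},
    {Sum.inr (i, true), Sum.inl (u i), Sum.inl (v i)} }

/-- The associated 3-graph built from the 2-paths `Pᵢ = {uᵢaᵢ, aᵢvᵢ}`. -/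
noncomputable def assocF {V : Type} {N : ℕ} (a u v : Fin N → V) :
    Finset (Finset (AssocVert V N)) :=
  (Finset.univ : Finset (Fin N)).sup (block a u v)

/-- The edge set of the 2-path `Pᵢ`. -/
noncomputable def pathEdges {V : Type} {N : ℕ} (a u v : Fin N → V) (i : Fin N) :
    Finset (Sym2 V) :=
  {s(u i, a i), s(a i, v i)}

/-- The vertex set `{uᵢ, aᵢ, vᵢ}` of the 2-path `Pᵢ`. -/
noncomputable def pathVerts {V : Type} {N : ℕ} (a u v : Fin N → V) (i : Fin N) :
    Finset V :=
  {u i, a i, v i}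

/-- The three edges of block `i`, indexed by `Fin 3`. -/
noncomputable def blockEdge {V : Type} {N : ℕ} (a u v : Fin N → V) (p : Fin N × Fin 3) :
    Finset (AssocVert V N) :=
  if p.2 = 0 then {Sum.inl (a p.1), Sum.inr (p.1, false), Sum.inr (p.1, true)}
  else if p.2 = 1 then {Sum.inr (p.1, false), Sum.inl (u p.1), Sum.inl (v p.1)}
  else {Sum.inr (p.1, true), Sum.inl (u p.1), Sum.inl (v p.1)}

theorem mem_false_blockEdge {V : Type} {N : ℕ} (a u v : Fin N → V) (i j : Fin N) (x : Fin 3) :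
    (Sum.inr (j, false) : AssocVert V N) ∈ blockEdge a u v (i, x) ↔ j = i ∧ x ≠ 2 := by
  fin_cases x <;> simp [blockEdge]

theorem mem_true_blockEdge {V : Type} {N : ℕ} (a u v : Fin N → V) (i j : Fin N) (x : Fin 3) :
    (Sum.inr (j, true) : AssocVert V N) ∈ blockEdge a u v (i, x) ↔ j = i ∧ x ≠ 1 := by
  fin_cases x <;> simp [blockEdge]

theorem blockEdge_injective {V : Type} {N : ℕ} (a u v : Fin N → V) :
    Function.Injective (blockEdge a u v) := by
  rintro ⟨i, x⟩ ⟨j, y⟩ h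
  have h1 : ∀ l, (l = i ∧ x ≠ 2) ↔ (l = j ∧ y ≠ 2) := fun l => by
    rw [← mem_false_blockEdge a u v, ← mem_false_blockEdge a u v, h]
  have h2 : ∀ l, (l = i ∧ x ≠ 1) ↔ (l = j ∧ y ≠ 1) := fun l => by
    rw [← mem_true_blockEdge a u v, ← mem_true_blockEdge a u v, h]
  have a1 := h1 i
  have a2 := h2 i
  have hij : i = j := by
    by_contra hne
    simp only [true_and, hne, false_and, iff_false, not_not] at a1 a2
    rw [a1] at a2
    exact absurd a2 (by decide)
  subst hij
  simp only [true_and] at a1 a2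
  have hxy : x = y := by
    clear h h1 h2
    revert x y
    decide
  rw [hxy]

theorem assocF_eq {V : Type} {N : ℕ} (a u v : Fin N → V) :
    assocF a u v = Finset.univ.image (blockEdge a u v) := by
  ext e
  simp only [assocF, Finset.mem_sup, Finset.mem_univ, true_and, Finset.mem_image, Prod.exists,
    block, Finset.mem_insert, Finset.mem_singleton]
  refine exists_congr fun i => ?_
  simp [blockEdge, Fin.exists_fin_succ, eq_comm]

/-- if any `j ∈ {1,…,8}` of the distinct 2-paths `P₁,…,P_N` together span at
least `j+2` vertices, then the associated 3-graph `F` has exactly `3N` edges and, for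
every `k ∈ {2,…,8}`, any `k` distinct edges of `F` span at least `k+2` vertices. -/
theorem assocF_card_and_sparse {V : Type} (H : SimpleGraph V) (N : ℕ)
    (a u v : Fin N → V)
    (hpath : ∀ i : Fin N, H.Adj (u i) (a i) ∧ H.Adj (a i) (v i) ∧ u i ≠ v i)
    (hdistinct : ∀ i j : Fin N, i ≠ j → pathEdges a u v i ≠ pathEdges a u v j)
    (hiv : ∀ j : ℕ, 1 ≤ j → j ≤ 8 → ∀ T : Finset (Fin N), T.card = j →
      j + 2 ≤ (T.sup (pathVerts a u v)).card) :
    (assocF a u v).card = 3 * N ∧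
      ∀ k : ℕ, 2 ≤ k → k ≤ 8 → ∀ S ⊆ assocF a u v, S.card = k →
        k + 2 ≤ (S.sup id).card := by
  have inj := blockEdge_injective a u v
  refine ⟨?_, ?_⟩
  · rw [assocF_eq, Finset.card_image_of_injective _ inj]
    simp [mul_comm]
  intro k hk2 hk8 S hS hSk
  set E : Fin 3 → Finset (Fin N) :=
    fun x => Finset.univ.filter fun i => blockEdge a u v (i, x) ∈ S with hE
  have memE : ∀ x i, i ∈ E x ↔ blockEdge a u v (i, x) ∈ S := by
    intro x i; simp [hE]
  -- the number of edges
  have hcard : k ≤ (E 0).card + (E 1).card + (E 2).card := by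
    have hsub : S ⊆ ((E 0).image fun i => blockEdge a u v (i, 0)) ∪
        ((E 1).image fun i => blockEdge a u v (i, 1)) ∪
        ((E 2).image fun i => blockEdge a u v (i, 2)) := by
      intro e he
      have h := hS he
      rw [assocF_eq, Finset.mem_image] at h
      obtain ⟨⟨i, x⟩, -, rfl⟩ := h
      have hi := (memE x i).2 he
      simp only [Finset.mem_union, Finset.mem_image]
      fin_cases x
      · exact Or.inl (Or.inl ⟨i, hi, rfl⟩)
      · exact Or.inl (Or.inr ⟨i, hi, rfl⟩)
      · exact Or.inr ⟨i, hi, rfl⟩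
    have h1 := Finset.card_le_card hsub
    have h2 := Finset.card_union_le (((E 0).image fun i => blockEdge a u v (i, 0)) ∪
        ((E 1).image fun i => blockEdge a u v (i, 1)))
        ((E 2).image fun i => blockEdge a u v (i, 2))
    have h3 := Finset.card_union_le ((E 0).image fun i => blockEdge a u v (i, 0))
        ((E 1).image fun i => blockEdge a u v (i, 1))
    have i0 : ((E 0).image fun i => blockEdge a u v (i, 0)).card ≤ _ := Finset.card_image_le
    have i1 : ((E 1).image fun i => blockEdge a u v (i, 1)).card ≤ _ := Finset.card_image_le
    have i2 : ((E 2).image fun i => blockEdge a u v (i, 2)).card ≤ _ := Finset.card_image_le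
    omega
  have memU : ∀ x i z, i ∈ E x → z ∈ blockEdge a u v (i, x) → z ∈ S.sup id := by
    intro x i z hi hz
    exact Finset.mem_sup.2 ⟨_, (memE x i).1 hi, hz⟩
  -- the number of vertices
  have hU : ∀ W : Finset V, (∀ w ∈ W, (Sum.inl w : AssocVert V N) ∈ S.sup id) →
      W.card + (E 0 ∪ E 1).card + (E 0 ∪ E 2).card ≤ (S.sup id).card := by
    intro W hW
    have hR : (((E 0 ∪ E 1).image fun i => (i, false)) ∪
        ((E 0 ∪ E 2).image fun i => (i, true))).card =
        (E 0 ∪ E 1).card + (E 0 ∪ E 2).card := by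
      rw [Finset.card_union_of_disjoint, Finset.card_image_of_injective,
        Finset.card_image_of_injective]
      · intro i j h; simpa using h
      · intro i j h; simpa using h
      · rw [Finset.disjoint_left]
        simp
    rw [add_assoc, ← hR, ← Finset.card_disjSum]
    apply Finset.card_le_card
    intro z hz
    rw [Finset.mem_disjSum] at hz
    rcases hz with ⟨w, hw, rfl⟩ | ⟨r, hr, rfl⟩
    · exact hW w hw
    · simp only [Finset.mem_union, Finset.mem_image] at hr
      rcases hr with ⟨i, hi | hi, rfl⟩ | ⟨i, hi | hi, rfl⟩
      · exact memU 0 i _ hi ((mem_false_blockEdge a u v _ _ _).2 ⟨rfl, by decide⟩)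
      · exact memU 1 i _ hi ((mem_false_blockEdge a u v _ _ _).2 ⟨rfl, by decide⟩)
      · exact memU 0 i _ hi ((mem_true_blockEdge a u v _ _ _).2 ⟨rfl, by decide⟩)
      · exact memU 2 i _ hi ((mem_true_blockEdge a u v _ _ _).2 ⟨rfl, by decide⟩)
  set T := (E 0 ∩ E 1) ∩ (E 0 ∩ E 2) with hT
  have c1 := Finset.card_union_add_card_inter (E 0) (E 1)
  have c2 := Finset.card_union_add_card_inter (E 0) (E 2)
  have c3 := Finset.card_union_add_card_inter (E 0 ∩ E 1) (E 0 ∩ E 2)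
  have c4 : ((E 0 ∩ E 1) ∪ (E 0 ∩ E 2)).card ≤ (E 0).card :=
    Finset.card_le_card (Finset.union_subset Finset.inter_subset_left Finset.inter_subset_left)
  rw [← hT] at c3
  have uvmem : ∀ i x, x ≠ 0 → i ∈ E x → (Sum.inl (u i) : AssocVert V N) ∈ S.sup id ∧
      (Sum.inl (v i) : AssocVert V N) ∈ S.sup id := by
    intro i x hx hi
    constructor <;> apply memU x i _ hi <;> fin_cases x <;> simp [blockEdge] at hx ⊢
  have amem : ∀ i, i ∈ E 0 → (Sum.inl (a i) : AssocVert V N) ∈ S.sup id := by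
    intro i hi
    apply memU 0 i _ hi
    simp [blockEdge]
  by_cases ht : T.card = 0
  · by_cases hx : ∃ x i, x ≠ 0 ∧ i ∈ E x
    · obtain ⟨x, i, hx, hi⟩ := hx
      have h := hU {u i, v i} (by
        intro w hw
        simp only [Finset.mem_insert, Finset.mem_singleton] at hw
        rcases hw with rfl | rfl
        · exact (uvmem i x hx hi).1
        · exact (uvmem i x hx hi).2)
      rw [Finset.card_pair (hpath i).2.2] at h
      omega
    · push Not at hx
      have e1 : (E 1).card = 0 :=
        Finset.card_eq_zero.2 (Finset.eq_empty_of_forall_notMem fun i => hx 1 i (by decide))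
      have e2 : (E 2).card = 0 :=
        Finset.card_eq_zero.2 (Finset.eq_empty_of_forall_notMem fun i => hx 2 i (by decide))
      have h := hU ∅ (by simp)
      have l1 := Finset.card_le_card (Finset.subset_union_left (s₁ := E 0) (s₂ := E 1))
      have l2 := Finset.card_le_card (Finset.subset_union_left (s₁ := E 0) (s₂ := E 2))
      omega
  · have ht8 : T.card ≤ k := by
      rw [← hSk]
      refine Finset.card_le_card_of_injOn (fun i => blockEdge a u v (i, 0)) ?_ ?_
      · intro i hi
        have hi : i ∈ T := hi
        simp only [hT, Finset.mem_inter] at hi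
        exact (memE 0 i).1 hi.1.1
      · intro i _ j _ h
        exact congrArg Prod.fst (inj h)
    have hW := hiv T.card (by omega) (by omega) T rfl
    have h := hU (T.sup (pathVerts a u v)) (by
      intro w hw
      obtain ⟨i, hi, hw⟩ := Finset.mem_sup.1 hw
      simp only [hT, Finset.mem_inter] at hi
      simp only [pathVerts, Finset.mem_insert, Finset.mem_singleton] at hw
      rcases hw with rfl | rfl | rfl
      · exact (uvmem i 1 (by decide) hi.1.2).1
      · exact amem i hi.1.1
      · exact (uvmem i 1 (by decide) hi.1.2).2)
    omega
end

section
/- Let H be a graph and P_1,…,P_N distinct 2-paths of H, where P_i has internal vertex a_i and endpoints u_i, v_i. Assume that (iii) the union graph of P_1,…,P_N contains no cycle of length 3, 4 or 5, and (iv) for every j ∈ {1,…,8}, the union of the vertex sets of any j distinct paths among P_1,…,P_N has at least j+2 elements. Let F be the associated 3-graph built from P_1,…,P_N. Then F contains no 4 distinct edges whose union has at most 6 vertices and no 8 distinct edges whose union has at most 10 vertices. -/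
open scoped Classical

lemma mem_pathVerts {V : Type} {N : ℕ} (a u v : Fin N → V) (i : Fin N) (x : V) :
    x ∈ pathVerts a u v i ↔ x = u i ∨ x = a i ∨ x = v i := by
  simp [pathVerts]

/-- Two vertices covered by at most two overlapping paths are joined, and a further path with
endpoints there closes a short cycle. -/
lemma short_cycle {V : Type} (H : SimpleGraph V) (N : ℕ)
    (a u v : Fin N → V)
    (hpath : ∀ i : Fin N, H.Adj (u i) (a i) ∧ H.Adj (a i) (v i) ∧ u i ≠ v i)
    (hiii : ∀ (x : V)
      (w : (SimpleGraph.fromEdgeSet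
        ((((Finset.univ : Finset (Fin N)).sup (pathEdges a u v)) : Finset (Sym2 V)) :
          Set (Sym2 V))).Walk x x),
      w.IsCycle → w.length ≠ 3 ∧ w.length ≠ 4 ∧ w.length ≠ 5)
    (hiv : ∀ j : ℕ, 1 ≤ j → j ≤ 8 → ∀ T : Finset (Fin N), T.card = j →
      j + 2 ≤ (T.sup (pathVerts a u v)).card)
    (T : Finset (Fin N)) (hT1 : 1 ≤ T.card) (hT2 : T.card ≤ 2)
    (hV : (T.sup (pathVerts a u v)).card ≤ T.card + 2)
    (j : Fin N) (hj : j ∉ T) (hu : u j ∈ T.sup (pathVerts a u v))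
    (hv : v j ∈ T.sup (pathVerts a u v)) : False := by
  have haj : a j ∉ T.sup (pathVerts a u v) := by
    intro ha
    have h := hiv (T.card + 1) (by omega) (by omega) (insert j T)
      (Finset.card_insert_of_notMem hj)
    have h2 : (insert j T).sup (pathVerts a u v) = T.sup (pathVerts a u v) := by
      rw [Finset.sup_insert]
      apply sup_eq_right.2
      intro x hx
      rcases (mem_pathVerts a u v j x).1 hx with rfl | rfl | rfl <;> assumption
    rw [h2] at h
    omega
  set G0 := SimpleGraph.fromEdgeSet
    (((T.sup (pathEdges a u v)) : Finset (Sym2 V)) : Set (Sym2 V)) with hG0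
  set G := SimpleGraph.fromEdgeSet
        ((((Finset.univ : Finset (Fin N)).sup (pathEdges a u v)) : Finset (Sym2 V)) :
          Set (Sym2 V)) with hG
  have hle : G0 ≤ G := by
    apply SimpleGraph.fromEdgeSet_mono
    exact Finset.coe_subset.2 (Finset.sup_mono (Finset.subset_univ T))
  have hadj : ∀ i, G.Adj (u i) (a i) ∧ G.Adj (a i) (v i) := by
    intro i
    simp only [hG, SimpleGraph.fromEdgeSet_adj, Finset.mem_coe, Finset.mem_sup]
    exact ⟨⟨⟨i, Finset.mem_univ _, by simp [pathEdges]⟩, (hpath i).1.ne⟩,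
      ⟨⟨i, Finset.mem_univ _, by simp [pathEdges]⟩, (hpath i).2.1.ne⟩⟩
  have hadj0 : ∀ i ∈ T, G0.Adj (u i) (a i) ∧ G0.Adj (a i) (v i) := by
    intro i hi
    simp only [hG0, SimpleGraph.fromEdgeSet_adj, Finset.mem_coe, Finset.mem_sup]
    exact ⟨⟨⟨i, hi, by simp [pathEdges]⟩, (hpath i).1.ne⟩,
      ⟨⟨i, hi, by simp [pathEdges]⟩, (hpath i).2.1.ne⟩⟩
  have hsupp : ∀ x y, G0.Adj x y → y ∈ T.sup (pathVerts a u v) := by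
    intro x y h
    simp only [hG0, SimpleGraph.fromEdgeSet_adj, Finset.mem_coe, Finset.mem_sup] at h
    obtain ⟨⟨i, hi, h⟩, -⟩ := h
    refine Finset.mem_sup.2 ⟨i, hi, ?_⟩
    rw [mem_pathVerts]
    simp only [pathEdges, Finset.mem_insert, Finset.mem_singleton, Sym2.eq_iff] at h
    tauto
  have hwsupp : ∀ x y (p : G0.Walk x y), x ∈ T.sup (pathVerts a u v) →
      ∀ z ∈ p.support, z ∈ T.sup (pathVerts a u v) := by
    intro x y p
    induction p with
    | nil => intro hx z hz; simp at hz; rwa [hz]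
    | cons h p ih =>
      intro hx z hz
      rw [SimpleGraph.Walk.support_cons, List.mem_cons] at hz
      rcases hz with rfl | hz
      · exact hx
      · exact ih (hsupp _ _ h) z hz
  have hri : ∀ i ∈ T, ∀ x ∈ pathVerts a u v i, G0.Reachable (a i) x := by
    intro i hi x hx
    rcases (mem_pathVerts a u v i x).1 hx with rfl | rfl | rfl
    · exact (hadj0 i hi).1.symm.reachable
    · exact SimpleGraph.Reachable.refl _
    · exact (hadj0 i hi).2.reachable
  have hcard : ∀ i, 3 ≤ (pathVerts a u v i).card := by
    intro i
    simpa using hiv 1 le_rfl (by norm_num) {i} (by simp)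
  have haa : ∀ i ∈ T, ∀ k ∈ T, G0.Reachable (a i) (a k) := by
    intro i hi k hk
    by_cases hik : i = k
    · subst hik; exact SimpleGraph.Reachable.refl _
    have hTe : ({i, k} : Finset (Fin N)) = T := by
      apply Finset.eq_of_subset_of_card_le
      · intro x hx
        simp at hx
        rcases hx with rfl | rfl <;> assumption
      · rw [Finset.card_pair hik]; exact hT2
    have hne : (pathVerts a u v i ∩ pathVerts a u v k).Nonempty := by
      rw [← Finset.card_pos]
      have h1 := Finset.card_union_add_card_inter (pathVerts a u v i) (pathVerts a u v k)
      have h2 : (pathVerts a u v i ∪ pathVerts a u v k) ⊆ T.sup (pathVerts a u v) :=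
        Finset.union_subset (Finset.le_sup (f := pathVerts a u v) hi)
          (Finset.le_sup (f := pathVerts a u v) hk)
      have h3 := Finset.card_le_card h2
      have := hcard i
      have := hcard k
      omega
    obtain ⟨x, hx⟩ := hne
    rw [Finset.mem_inter] at hx
    exact (hri i hi x hx.1).trans (hri k hk x hx.2).symm
  have hreach : G0.Reachable (u j) (v j) := by
    obtain ⟨i, hi, hui⟩ := Finset.mem_sup.1 hu
    obtain ⟨k, hk, hvk⟩ := Finset.mem_sup.1 hv
    exact (hri i hi _ hui).symm.trans ((haa i hi k hk).trans (hri k hk _ hvk))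
  obtain ⟨p, hp⟩ := hreach.exists_isPath
  have hlen : p.length + 1 ≤ 4 := by
    rw [← SimpleGraph.Walk.length_support, ← List.toFinset_card_of_nodup hp.support_nodup]
    refine le_trans (Finset.card_le_card ?_) (hV.trans (by omega))
    intro z hz
    exact hwsupp _ _ p hu z (List.mem_toFinset.1 hz)
  have hlen1 : 1 ≤ p.length := by
    rcases Nat.eq_zero_or_pos p.length with h | h
    · exact absurd (SimpleGraph.Walk.eq_of_length_eq_zero h) (hpath j).2.2
    · exact h
  have hap : a j ∉ (p.mapLe hle).support := by
    rw [SimpleGraph.Walk.support_mapLe_eq_support]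
    exact fun h => haj (hwsupp _ _ p hu _ h)
  have hq : (SimpleGraph.Walk.cons (hadj j).1.symm (p.mapLe hle)).IsPath :=
    (hp.mapLe hle).cons hap
  have hcyc : (SimpleGraph.Walk.cons (hadj j).2.symm
      (SimpleGraph.Walk.cons (hadj j).1.symm (p.mapLe hle))).IsCycle := by
    rw [SimpleGraph.Walk.cons_isCycle_iff]
    refine ⟨hq, ?_⟩
    rw [SimpleGraph.Walk.edges_cons, List.mem_cons]
    rintro (h | h)
    · rw [Sym2.eq_iff] at h
      rcases h with ⟨h1, h2⟩ | ⟨h1, h2⟩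
      · exact (hpath j).2.1.ne h1.symm
      · exact (hpath j).2.2 h1.symm
    · exact hap (SimpleGraph.Walk.snd_mem_support_of_mem_edges _ h)
  have := hiii _ _ hcyc
  simp at this
  omega

lemma count_aux (p q r x y : Prop) [Decidable p] [Decidable q] [Decidable r] [Decidable x]
    [Decidable y] [Decidable (p ∧ ¬ q ∧ ¬ r)] [Decidable (p ∧ q ∧ r)] (hp : p → x ∧ y) (hq : q → x) (hr : r → y) :
    ((if p then 1 else 0) + ((if q then 1 else 0) + (if r then 1 else 0))) +
      (if p ∧ ¬ q ∧ ¬ r then 1 else 0) ≤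
    ((if x then 1 else 0) + (if y then 1 else 0)) + (if p ∧ q ∧ r then 1 else 0 : ℕ) := by
  by_cases p <;> by_cases q <;> by_cases r <;> simp_all

set_option maxHeartbeats 1000000 in
lemma main_count {V : Type} (H : SimpleGraph V) (N : ℕ)
    (a u v : Fin N → V)
    (hpath : ∀ i : Fin N, H.Adj (u i) (a i) ∧ H.Adj (a i) (v i) ∧ u i ≠ v i)
    (hiii : ∀ (x : V)
      (w : (SimpleGraph.fromEdgeSet
        ((((Finset.univ : Finset (Fin N)).sup (pathEdges a u v)) : Finset (Sym2 V)) :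
          Set (Sym2 V))).Walk x x),
      w.IsCycle → w.length ≠ 3 ∧ w.length ≠ 4 ∧ w.length ≠ 5)
    (hiv : ∀ j : ℕ, 1 ≤ j → j ≤ 8 → ∀ T : Finset (Fin N), T.card = j →
      j + 2 ≤ (T.sup (pathVerts a u v)).card)
    (S : Finset (Finset (AssocVert V N))) (hS : S ⊆ assocF a u v)
    (hSc : S.card = 4 ∨ S.card = 8) (hX : (S.sup id).card ≤ S.card + 2) : False := by
  set C := (S.sup id).toLeft with hC
  set W := (S.sup id).toRight with hW
  have hCW : C.card + W.card = (S.sup id).card := Finset.card_toLeft_add_card_toRight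
  set e1 : Fin N → Finset (AssocVert V N) :=
    fun i => {Sum.inl (a i), Sum.inr (i, false), Sum.inr (i, true)} with he1
  set e2 : Fin N → Finset (AssocVert V N) :=
    fun i => {Sum.inr (i, false), Sum.inl (u i), Sum.inl (v i)} with he2
  set e3 : Fin N → Finset (AssocVert V N) :=
    fun i => {Sum.inr (i, true), Sum.inl (u i), Sum.inl (v i)} with he3
  have hblock : ∀ i, block a u v i = {e1 i, e2 i, e3 i} := fun i => rfl
  have h12 : ∀ i, e1 i ≠ e2 i := by
    intro i h
    have : (Sum.inr (i, true) : AssocVert V N) ∈ e2 i := by rw [← h]; simp [he1]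
    simp [he2] at this
  have h13 : ∀ i, e1 i ≠ e3 i := by
    intro i h
    have : (Sum.inr (i, false) : AssocVert V N) ∈ e3 i := by rw [← h]; simp [he1]
    simp [he3] at this
  have h23 : ∀ i, e2 i ≠ e3 i := by
    intro i h
    have : (Sum.inr (i, false) : AssocVert V N) ∈ e3 i := by rw [← h]; simp [he2]
    simp [he3] at this
  set s : Fin N → ℕ := fun i => (if e1 i ∈ S then 1 else 0) +
    ((if e2 i ∈ S then 1 else 0) + (if e3 i ∈ S then 1 else 0)) with hs
  have hscard : ∀ i, ((block a u v i).filter (· ∈ S)).card = s i := by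
    intro i
    rw [Finset.card_filter, hblock, Finset.sum_insert, Finset.sum_insert, Finset.sum_singleton]
    · simpa using h23 i
    · simp [h12 i, h13 i]
  have hidx : ∀ i k, ∀ e ∈ block a u v i, e ∈ block a u v k → i = k := by
    intro i k e hi hk
    have h1 : ∃ b, (Sum.inr (i, b) : AssocVert V N) ∈ e := by
      simp only [hblock, Finset.mem_insert, Finset.mem_singleton] at hi
      rcases hi with rfl | rfl | rfl
      · exact ⟨true, by simp [he1]⟩
      · exact ⟨false, by simp [he2]⟩
      · exact ⟨true, by simp [he3]⟩
    obtain ⟨b, hb⟩ := h1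
    simp only [hblock, Finset.mem_insert, Finset.mem_singleton] at hk
    rcases hk with rfl | rfl | rfl
    · simp [he1] at hb; tauto
    · simp [he2] at hb; tauto
    · simp [he3] at hb; tauto
  have hSsum : S.card = ∑ i, s i := by
    have : S = (Finset.univ : Finset (Fin N)).biUnion
        (fun i => (block a u v i).filter (· ∈ S)) := by
      ext e
      simp only [Finset.mem_biUnion, Finset.mem_univ, true_and, Finset.mem_filter]
      constructor
      · intro h
        obtain ⟨i, -, hi⟩ := Finset.mem_sup.1 (hS h)
        exact ⟨i, hi, h⟩
      · rintro ⟨i, -, h⟩; exact h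
    conv_lhs => rw [this]
    rw [Finset.card_biUnion]
    · exact Finset.sum_congr rfl fun i _ => hscard i
    · intro i _ k _ hik
      simp only [Function.onFun]
      rw [Finset.disjoint_left]
      intro e h1 h2
      exact hik (hidx i k e (Finset.mem_filter.1 h1).1 (Finset.mem_filter.1 h2).1)
  have hmemX : ∀ e ∈ S, ∀ x ∈ e, x ∈ S.sup id := fun e he x hx =>
    Finset.mem_sup.2 ⟨e, he, hx⟩
  have hA : ∀ i, e1 i ∈ S → a i ∈ C ∧ (i, false) ∈ W ∧ (i, true) ∈ W := by
    intro i h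
    simp only [hC, hW, Finset.mem_toLeft, Finset.mem_toRight]
    exact ⟨hmemX _ h _ (by simp [he1]), hmemX _ h _ (by simp [he1]), hmemX _ h _ (by simp [he1])⟩
  have hB : ∀ i, e2 i ∈ S → u i ∈ C ∧ v i ∈ C ∧ (i, false) ∈ W := by
    intro i h
    simp only [hC, hW, Finset.mem_toLeft, Finset.mem_toRight]
    exact ⟨hmemX _ h _ (by simp [he2]), hmemX _ h _ (by simp [he2]), hmemX _ h _ (by simp [he2])⟩
  have hD : ∀ i, e3 i ∈ S → u i ∈ C ∧ v i ∈ C ∧ (i, true) ∈ W := by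
    intro i h
    simp only [hC, hW, Finset.mem_toLeft, Finset.mem_toRight]
    exact ⟨hmemX _ h _ (by simp [he3]), hmemX _ h _ (by simp [he3]), hmemX _ h _ (by simp [he3])⟩
  set T := (Finset.univ : Finset (Fin N)).filter
    (fun i => e1 i ∈ S ∧ e2 i ∈ S ∧ e3 i ∈ S) with hT
  set A := (Finset.univ : Finset (Fin N)).filter
    (fun i => e1 i ∈ S ∧ e2 i ∉ S ∧ e3 i ∉ S) with hAdef
  have hWsum : W.card = ∑ i, (W.filter (fun x => x.1 = i)).card :=
    Finset.card_eq_sum_card_fiberwise (fun x _ => Finset.mem_coe.2 (Finset.mem_univ x.1))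
  have hw : ∀ i, (if (i, false) ∈ W then 1 else 0) + (if (i, true) ∈ W then 1 else 0)
      ≤ (W.filter (fun x => x.1 = i)).card := by
    intro i
    have h1 : ((({(i, false), (i, true)} : Finset (Fin N × Bool))).filter (· ∈ W)).card =
      (if (i, false) ∈ W then 1 else 0) + (if (i, true) ∈ W then 1 else 0) := by
      rw [Finset.card_filter, Finset.sum_insert (by simp), Finset.sum_singleton]
    rw [← h1]
    apply Finset.card_le_card
    intro x hx
    simp only [Finset.mem_filter, Finset.mem_insert, Finset.mem_singleton] at hx ⊢
    rcases hx with ⟨rfl | rfl, h⟩ <;> exact ⟨h, rfl⟩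
  have hloc : ∀ i, s i + (if e1 i ∈ S ∧ e2 i ∉ S ∧ e3 i ∉ S then 1 else 0) ≤
      (W.filter (fun x => x.1 = i)).card + (if e1 i ∈ S ∧ e2 i ∈ S ∧ e3 i ∈ S then 1 else 0) := by
    intro i
    refine le_trans ?_ (Nat.add_le_add_right (hw i) _)
    have h1 := hA i
    have h2 := hB i
    have h3 := hD i
    simp only [hs]
    exact count_aux _ _ _ _ _ (fun h => (h1 h).2) (fun h => (h2 h).2.2) (fun h => (h3 h).2.2)
  have hsum := Finset.sum_le_sum (s := (Finset.univ : Finset (Fin N))) fun i _ => hloc i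
  rw [Finset.sum_add_distrib (f := s), ← hSsum, ← Finset.card_filter,
    Finset.sum_add_distrib, ← hWsum, ← Finset.card_filter, ← hT, ← hAdef] at hsum
  have hmain : C.card + A.card ≤ T.card + 2 := by omega
  have hsT : ∀ i ∈ T, s i = 3 := by
    intro i hi
    have := (Finset.mem_filter.1 hi).2
    simp [hs, this]
  have hs3 : ∀ i, s i ≤ 3 := by
    intro i
    simp only [hs]
    split_ifs <;> omega
  have hTS : S.card = 3 * T.card + ∑ i ∈ Finset.univ \ T, s i := by
    rw [hSsum, ← Finset.sum_sdiff (Finset.subset_univ T), Finset.sum_congr rfl hsT]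
    simp; omega
  have hpos : ∀ i, s i ≠ 0 → i ∉ A → u i ∈ C ∧ v i ∈ C := by
    intro i hi hiA
    by_cases p2 : e2 i ∈ S
    · exact ⟨(hB i p2).1, (hB i p2).2.1⟩
    by_cases p3 : e3 i ∈ S
    · exact ⟨(hD i p3).1, (hD i p3).2.1⟩
    by_cases p1 : e1 i ∈ S
    · exact absurd (by simp [hAdef, p1, p2, p3]) hiA
    · exact absurd (by simp [hs, p1, p2, p3]) hi
  have hVT : T.sup (pathVerts a u v) ⊆ C := by
    intro x hx
    obtain ⟨i, hi, hx⟩ := Finset.mem_sup.1 hx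
    have hi := (Finset.mem_filter.1 hi).2
    rcases (mem_pathVerts a u v i x).1 hx with rfl | rfl | rfl
    · exact (hB i hi.2.1).1
    · exact (hA i hi.1).1
    · exact (hB i hi.2.1).2.1
  have hVTc := Finset.card_le_card hVT
  rcases Nat.eq_zero_or_pos T.card with hT0 | hTpos
  · by_cases hex : ∃ j, s j ≠ 0 ∧ j ∉ A
    · obtain ⟨j, hj, hjA⟩ := hex
      have hjC := hpos j hj hjA
      have hsub : ({u j, v j} : Finset V) ⊆ C := by
        intro x hx
        simp only [Finset.mem_insert, Finset.mem_singleton] at hx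
        rcases hx with rfl | rfl
        · exact hjC.1
        · exact hjC.2
      have hc2 : ({u j, v j} : Finset V).card = 2 := Finset.card_pair (hpath j).2.2
      have hc := Finset.card_le_card hsub
      have hCe := Finset.eq_of_subset_of_card_le hsub (by omega)
      have hA0 : A = ∅ := Finset.card_eq_zero.1 (by omega)
      have : ∃ k, k ≠ j ∧ s k ≠ 0 := by
        by_contra hno
        push Not at hno
        have := hs3 j
        have h1 : ∑ i, s i = s j :=
          Finset.sum_eq_single j (fun b _ hb => hno b hb) (by simp)
        omega
      obtain ⟨k, hkj, hk⟩ := this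
      have hkC := hpos k hk (by simp [hA0])
      have hCV : C ⊆ ({j} : Finset (Fin N)).sup (pathVerts a u v) := by
        rw [← hCe]
        intro x hx
        simp only [Finset.mem_insert, Finset.mem_singleton] at hx
        rw [Finset.sup_singleton, mem_pathVerts]
        tauto
      refine short_cycle H N a u v hpath hiii hiv {j} (by simp) (by simp) ?_ k (by simpa using hkj)
        (hCV hkC.1) (hCV hkC.2)
      rw [Finset.sup_singleton, Finset.card_singleton]
      exact Finset.card_le_three
    · push Not at hex
      have h1 : ∑ i, s i ≤ ∑ i, (if e1 i ∈ S ∧ e2 i ∉ S ∧ e3 i ∉ S then 1 else 0) := by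
        apply Finset.sum_le_sum
        intro i _
        by_cases hi : s i = 0
        · omega
        · have := (Finset.mem_filter.1 (hex i hi)).2
          simp [hs, this]
      rw [← Finset.card_filter, ← hAdef] at h1
      omega
  · have h8 := hiv T.card hTpos (by omega) T rfl
    have hCe := Finset.eq_of_subset_of_card_le hVT (by omega)
    have hA0 : A = ∅ := Finset.card_eq_zero.1 (by omega)
    have : ∃ k, k ∉ T ∧ s k ≠ 0 := by
      by_contra hno
      push Not at hno
      have h1 : ∑ i ∈ Finset.univ \ T, s i = 0 :=
        Finset.sum_eq_zero fun i hi => hno i (Finset.mem_sdiff.1 hi).2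
      omega
    obtain ⟨k, hkT, hk⟩ := this
    have hkC := hpos k hk (by simp [hA0])
    rw [← hCe] at hkC
    exact short_cycle H N a u v hpath hiii hiv T hTpos (by omega) (by omega) k hkT hkC.1 hkC.2

/-- under conditions (iii) (the union graph of the paths has no cycle of
length 3, 4 or 5) and (iv) (any `j ∈ {1,…,8}` distinct paths span at least `j+2`
vertices), the associated 3-graph `F` contains no 4 distinct edges on at most 6 vertices
and no 8 distinct edges on at most 10 vertices. -/
theorem assocF_4free_8free {V : Type} (H : SimpleGraph V) (N : ℕ)
    (a u v : Fin N → V)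
    (hpath : ∀ i : Fin N, H.Adj (u i) (a i) ∧ H.Adj (a i) (v i) ∧ u i ≠ v i)
    (hdistinct : ∀ i j : Fin N, i ≠ j → pathEdges a u v i ≠ pathEdges a u v j)
    (hiii : ∀ (x : V)
      (w : (SimpleGraph.fromEdgeSet
        ((((Finset.univ : Finset (Fin N)).sup (pathEdges a u v)) : Finset (Sym2 V)) :
          Set (Sym2 V))).Walk x x),
      w.IsCycle → w.length ≠ 3 ∧ w.length ≠ 4 ∧ w.length ≠ 5)
    (hiv : ∀ j : ℕ, 1 ≤ j → j ≤ 8 → ∀ T : Finset (Fin N), T.card = j →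
      j + 2 ≤ (T.sup (pathVerts a u v)).card) :
    (¬ ∃ S ⊆ assocF a u v, S.card = 4 ∧ (S.sup id).card ≤ 6) ∧
      (¬ ∃ S ⊆ assocF a u v, S.card = 8 ∧ (S.sup id).card ≤ 10) := by
  constructor
  · rintro ⟨S, hS, hc, hX⟩
    exact main_count H N a u v hpath hiii hiv S hS (Or.inl hc) (by omega)
  · rintro ⟨S, hS, hc, hX⟩
    exact main_count H N a u v hpath hiii hiv S hS (Or.inr hc) (by omega)
end

section
/- Let H be a graph and P_1,…,P_N distinct 2-paths of H, where P_i has internal vertex a_i and endpoints u_i, v_i. Assume that (iii) the union graph of P_1,…,P_N contains no cycle of length 3, 4 or 5, and (iv) for every j ∈ {1,…,8}, the union of the vertex sets of any j distinct paths among P_1,…,P_N has at least j+2 elements. Let F be the associated 3-graph built from P_1,…,P_N. Then the number of pairs of distinct vertices of F that are 1-claimed by F equals 8N, and the number of pairs of distinct vertices of F that are i-claimed by F for some i ∈ {1,2,3,4} is at least 8N and at most 8N plus the number of edges of the union graph of P_1,…,P_N. -/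
open scoped Classical

theorem aux_mem_E {V : Type} {N : ℕ} (a u v : Fin N → V) (e : Sym2 V) :
    e ∈ (Finset.univ : Finset (Fin N)).sup (pathEdges a u v) ↔
      ∃ i, e = s(u i, a i) ∨ e = s(a i, v i) := by
  simp [Finset.mem_sup, pathEdges]

theorem aux_mem_F {V : Type} {N : ℕ} (a u v : Fin N → V) (X : Finset (AssocVert V N)) :
    X ∈ assocF a u v ↔ ∃ i, X ∈ block a u v i := by
  simp [Finset.mem_sup, assocF]

theorem aux_tri {V : Type} (E : Set (Sym2 V))
    (hiii : ∀ (x : V) (w : (SimpleGraph.fromEdgeSet E).Walk x x),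
      w.IsCycle → w.length ≠ 3 ∧ w.length ≠ 4 ∧ w.length ≠ 5)
    (x y z : V) (h1 : s(x, y) ∈ E) (h2 : s(y, z) ∈ E) (h3 : s(z, x) ∈ E)
    (hxy : x ≠ y) (hyz : y ≠ z) (hzx : z ≠ x) : False := by
  have a1 : (SimpleGraph.fromEdgeSet E).Adj x y := by simp [h1, hxy]
  have a2 : (SimpleGraph.fromEdgeSet E).Adj y z := by simp [h2, hyz]
  have a3 : (SimpleGraph.fromEdgeSet E).Adj z x := by simp [h3, hzx]
  refine (hiii x (.cons a1 (.cons a2 (.cons a3 .nil))) ?_).1 rfl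
  rw [SimpleGraph.Walk.cons_isCycle_iff]
  simp [SimpleGraph.Walk.cons_isPath_iff]
  grind

theorem aux_quad {V : Type} (E : Set (Sym2 V))
    (hiii : ∀ (x : V) (w : (SimpleGraph.fromEdgeSet E).Walk x x),
      w.IsCycle → w.length ≠ 3 ∧ w.length ≠ 4 ∧ w.length ≠ 5)
    (x y z t : V) (h1 : s(x, y) ∈ E) (h2 : s(y, z) ∈ E) (h3 : s(z, t) ∈ E)
    (h4 : s(t, x) ∈ E)
    (hxy : x ≠ y) (hyz : y ≠ z) (hzt : z ≠ t) (htx : t ≠ x) (hxz : x ≠ z) (hyt : y ≠ t) :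
    False := by
  have a1 : (SimpleGraph.fromEdgeSet E).Adj x y := by simp [h1, hxy]
  have a2 : (SimpleGraph.fromEdgeSet E).Adj y z := by simp [h2, hyz]
  have a3 : (SimpleGraph.fromEdgeSet E).Adj z t := by simp [h3, hzt]
  have a4 : (SimpleGraph.fromEdgeSet E).Adj t x := by simp [h4, htx]
  refine (hiii x (.cons a1 (.cons a2 (.cons a3 (.cons a4 .nil)))) ?_).2.1 rfl
  rw [SimpleGraph.Walk.cons_isCycle_iff]
  simp [SimpleGraph.Walk.cons_isPath_iff]
  grind

/-- The eight pairs covered by three triples on five distinct points. -/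
noncomputable def auxPairs {W : Type} [DecidableEq W] (a b c u v : W) : Finset (Finset W) :=
  { {a, b}, {a, c}, {b, c}, {b, u}, {b, v}, {c, u}, {c, v}, {u, v} }

theorem aux_pair_eq {W : Type} [DecidableEq W] (x y z w : W) :
    ({x, y} : Finset W) = {z, w} ↔ (x = z ∧ y = w) ∨ (x = w ∧ y = z) := by
  constructor
  · intro h
    have h1 : x ∈ ({z, w} : Finset W) := h ▸ (by simp)
    have h2 : y ∈ ({z, w} : Finset W) := h ▸ (by simp)
    have h3 : z ∈ ({x, y} : Finset W) := h ▸ (by simp)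
    have h4 : w ∈ ({x, y} : Finset W) := h ▸ (by simp)
    simp only [Finset.mem_insert, Finset.mem_singleton] at h1 h2 h3 h4
    grind
  · rintro (⟨rfl, rfl⟩ | ⟨rfl, rfl⟩)
    · rfl
    · exact Finset.pair_comm _ _

theorem aux_pairs_card {W : Type} [DecidableEq W] (a b c u v : W) (hab : a ≠ b) (hac : a ≠ c) (hau : a ≠ u)
    (hav : a ≠ v) (hbc : b ≠ c) (hbu : b ≠ u) (hbv : b ≠ v) (hcu : c ≠ u) (hcv : c ≠ v)
    (huv : u ≠ v) : (auxPairs a b c u v).card = 8 := by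
  unfold auxPairs
  repeat rw [Finset.card_insert_of_notMem]
  all_goals simp [aux_pair_eq]
  all_goals grind

theorem aux_mem_pairs {W : Type} [DecidableEq W] (a b c u v : W) (hab : a ≠ b) (hac : a ≠ c)
    (hbc : b ≠ c) (hbu : b ≠ u) (hbv : b ≠ v) (hcu : c ≠ u) (hcv : c ≠ v)
    (huv : u ≠ v) (p : Finset W) : p ∈ auxPairs a b c u v ↔
      p.card = 2 ∧ (p ⊆ {a, b, c} ∨ p ⊆ {b, u, v} ∨ p ⊆ {c, u, v}) := by
  constructor
  · intro h
    simp only [auxPairs, Finset.mem_insert, Finset.mem_singleton] at h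
    rcases h with rfl | rfl | rfl | rfl | rfl | rfl | rfl | rfl <;>
      refine ⟨Finset.card_pair (by assumption), ?_⟩ <;>
      simp [Finset.insert_subset_iff]
  · rintro ⟨h, h'⟩
    obtain ⟨x, y, hxy, rfl⟩ := Finset.card_eq_two.1 h
    simp only [auxPairs, Finset.mem_insert, Finset.mem_singleton, aux_pair_eq,
      Finset.insert_subset_iff, Finset.singleton_subset_iff] at h' ⊢
    grind

theorem aux_block_mem {V : Type} {N : ℕ} (a u v : Fin N → V) (i : Fin N)
    (X : Finset (AssocVert V N)) : X ∈ block a u v i ↔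
      X = {Sum.inl (a i), Sum.inr (i, false), Sum.inr (i, true)} ∨
      X = {Sum.inr (i, false), Sum.inl (u i), Sum.inl (v i)} ∨
      X = {Sum.inr (i, true), Sum.inl (u i), Sum.inl (v i)} := by
  simp [block]

/-- the pairs of block `i` -/
noncomputable def auxC {V : Type} {N : ℕ} (a u v : Fin N → V) (i : Fin N) :
    Finset (Finset (AssocVert V N)) :=
  auxPairs (Sum.inl (a i)) (Sum.inr (i, false)) (Sum.inr (i, true)) (Sum.inl (u i))
    (Sum.inl (v i))

theorem aux_C_mem {V : Type} {N : ℕ} (a u v : Fin N → V) (i : Fin N) (huv : u i ≠ v i)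
    (p : Finset (AssocVert V N)) : p ∈ auxC a u v i ↔
      p.card = 2 ∧ ∃ X ∈ block a u v i, p ⊆ X := by
  unfold auxC
  rw [aux_mem_pairs _ _ _ _ _ (by simp) (by simp) (by simp) (by simp) (by simp) (by simp)
    (by simp) (by simpa using huv)]
  simp [aux_block_mem]

theorem aux_C_disj {V : Type} {N : ℕ} (a u v : Fin N → V) (i j : Fin N) (hij : i ≠ j)
    (h : ¬ ((u i = u j ∧ v i = v j) ∨ (u i = v j ∧ v i = u j))) :
    Disjoint (auxC a u v i) (auxC a u v j) := by
  rw [Finset.disjoint_left]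
  intro p hp hq
  simp only [auxC, auxPairs, Finset.mem_insert, Finset.mem_singleton] at hp
  rcases hp with rfl | rfl | rfl | rfl | rfl | rfl | rfl | rfl <;>
    simp [auxC, auxPairs, aux_pair_eq, hij] at hq
  grind

theorem aux_sum {V : Type} {N : ℕ} (a u v : Fin N → V) (S : Finset (Finset (AssocVert V N)))
    (hS : S ⊆ assocF a u v) (U : Finset (AssocVert V N)) (hU : ∀ X ∈ S, X ⊆ U)
    (hfull : ∀ i, ¬ block a u v i ⊆ S)
    (T : Finset (Fin N))
    (hT : ∀ i ∈ T, {Sum.inl (a i), Sum.inr (i, false), Sum.inr (i, true)} ∈ S ∧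
      {Sum.inr (i, false), Sum.inl (u i), Sum.inl (v i)} ∉ S ∧
      {Sum.inr (i, true), Sum.inl (u i), Sum.inl (v i)} ∉ S) :
    S.card + T.card ≤ U.toRight.card := by
  have h1 : S.card ≤ ∑ i, ((block a u v i).filter (· ∈ S)).card := by
    refine le_trans (Finset.card_le_card ?_) Finset.card_biUnion_le
    intro X hX
    obtain ⟨i, hi⟩ := (aux_mem_F a u v X).1 (hS hX)
    simp only [Finset.mem_biUnion, Finset.mem_filter, Finset.mem_univ, true_and]
    exact ⟨i, hi, hX⟩
  have h2 : U.toRight.card = ∑ i, (U.toRight.filter (fun q => q.1 = i)).card :=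
    Finset.card_eq_sum_card_fiberwise (by simp)
  have h3 : T.card = ∑ i, if i ∈ T then 1 else 0 := by simp
  rw [h2, h3]
  refine le_trans (Nat.add_le_add_right h1 _) ?_
  rw [← Finset.sum_add_distrib]
  refine Finset.sum_le_sum fun i _ => ?_
  have hf := hfull i
  have hTi := hT i
  have hcard2 : ({(i, false), (i, true)} : Finset (Fin N × Bool)).card = 2 :=
    Finset.card_pair (by simp)
  have two : Sum.inr (i, false) ∈ U → Sum.inr (i, true) ∈ U →
      2 ≤ (U.toRight.filter (fun q => q.1 = i)).card := by
    intro hb hc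
    rw [← hcard2]
    apply Finset.card_le_card
    simp [Finset.insert_subset_iff, hb, hc]
  have one : ∀ t, Sum.inr (i, t) ∈ U →
      1 ≤ (U.toRight.filter (fun q => q.1 = i)).card := by
    intro t hb
    rw [Nat.one_le_iff_ne_zero, Finset.card_ne_zero]
    exact ⟨(i, t), by simp [hb]⟩
  by_cases hA : ({Sum.inl (a i), Sum.inr (i, false), Sum.inr (i, true)} :
      Finset (AssocVert V N)) ∈ S <;>
  by_cases hB : ({Sum.inr (i, false), Sum.inl (u i), Sum.inl (v i)} :
      Finset (AssocVert V N)) ∈ S <;>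
  by_cases hC : ({Sum.inr (i, true), Sum.inl (u i), Sum.inl (v i)} :
      Finset (AssocVert V N)) ∈ S
  · exact absurd (by simp [block, Finset.insert_subset_iff, hA, hB, hC]) hf
  all_goals
    simp only [block, Finset.filter_insert, Finset.filter_singleton, hA, hB, hC, if_true,
      if_false]
    simp only [hA, hB, hC, not_true, not_false_iff, and_true, and_false, true_and,
      false_and, imp_false] at hTi
    try simp only [hTi, if_false, add_zero]
  · have := hU _ hA
    refine le_trans Finset.card_le_two (two (this (by simp)) (this (by simp)))
  · have := hU _ hA
    refine le_trans Finset.card_le_two (two (this (by simp)) (this (by simp)))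
  · have := hU _ hA
    refine le_trans ?_ (two (this (by simp)) (this (by simp)))
    split_ifs <;> simp
  · refine le_trans Finset.card_le_two (two (hU _ hB (by simp)) (hU _ hC (by simp)))
  · simpa using one false (hU _ hB (by simp))
  · simpa using one true (hU _ hC (by simp))
  · simp

set_option maxHeartbeats 1000000 in
theorem aux_key {V : Type} {N : ℕ} (a u v : Fin N → V)
    (hne : ∀ i, u i ≠ a i ∧ a i ≠ v i ∧ u i ≠ v i)
    (huv : ∀ i j, i ≠ j → ¬ ((u i = u j ∧ v i = v j) ∨ (u i = v j ∧ v i = u j)))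
    (htri : ∀ i j, i ≠ j → ∀ x, (x = u i ∨ x = v i) →
      ¬ ((u j = a i ∧ v j = x) ∨ (v j = a i ∧ u j = x)))
    (S : Finset (Finset (AssocVert V N))) (hS : S ⊆ assocF a u v)
    (hS1 : 1 ≤ S.card) (hS4 : S.card ≤ 4) (p : Finset (AssocVert V N)) (hp : p.card = 2)
    (hc : (p ∪ S.sup id).card ≤ S.card + 2) :
    (∃ i, p ∈ auxC a u v i) ∨ ∃ i, p = {Sum.inl (u i), Sum.inl (a i)} ∨
      p = {Sum.inl (a i), Sum.inl (v i)} := by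
  set U := p ∪ S.sup id with hUdef
  have hpU : p ⊆ U := Finset.subset_union_left
  have hU : ∀ X ∈ S, X ⊆ U := fun X hX =>
    (Finset.le_sup (f := id) hX).trans Finset.subset_union_right
  have hcard5 : ∀ i, ({Sum.inl (a i), Sum.inr (i, false), Sum.inr (i, true), Sum.inl (u i),
      Sum.inl (v i)} : Finset (AssocVert V N)).card = 5 := by
    intro i
    have := hne i
    repeat rw [Finset.card_insert_of_notMem]
    all_goals simp
    all_goals grind
  have hcardblock : ∀ i, (block a u v i).card = 3 := by
    intro i
    unfold block
    repeat rw [Finset.card_insert_of_notMem]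
    all_goals simp
    · intro h
      have : (Sum.inr (i, false) : AssocVert V N) ∈
        ({Sum.inr (i, true), Sum.inl (u i), Sum.inl (v i)} : Finset (AssocVert V N)) := by
        rw [← h]; simp
      simp at this
    · constructor <;> intro h
      · have : (Sum.inr (i, true) : AssocVert V N) ∈
          ({Sum.inr (i, false), Sum.inl (u i), Sum.inl (v i)} : Finset (AssocVert V N)) := by
          rw [← h]; simp
        simp at this
      · have : (Sum.inr (i, false) : AssocVert V N) ∈
          ({Sum.inr (i, true), Sum.inl (u i), Sum.inl (v i)} : Finset (AssocVert V N)) := by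
          rw [← h]; simp
        simp at this
  -- pairs inside a block's vertex set
  have hin : ∀ i, p ⊆ {Sum.inl (a i), Sum.inr (i, false), Sum.inr (i, true), Sum.inl (u i),
      Sum.inl (v i)} → (∃ i, p ∈ auxC a u v i) ∨ ∃ i, p = {Sum.inl (u i), Sum.inl (a i)} ∨
      p = {Sum.inl (a i), Sum.inl (v i)} := by
    intro i hi
    obtain ⟨x, y, hxy, rfl⟩ := Finset.card_eq_two.1 hp
    suffices ({x, y} ∈ auxC a u v i) ∨ (({x, y} : Finset (AssocVert V N)) =
        {Sum.inl (u i), Sum.inl (a i)} ∨ ({x, y} : Finset (AssocVert V N)) =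
        {Sum.inl (a i), Sum.inl (v i)}) by
      rcases this with h | h
      · exact Or.inl ⟨i, h⟩
      · exact Or.inr ⟨i, h⟩
    simp only [auxC, auxPairs, Finset.mem_insert, Finset.mem_singleton, aux_pair_eq,
      Finset.insert_subset_iff, Finset.singleton_subset_iff] at hi ⊢
    obtain ⟨hx, hy⟩ := hi
    rcases hx with rfl | rfl | rfl | rfl | rfl <;>
    rcases hy with rfl | rfl | rfl | rfl | rfl <;>
    first
    | exact absurd rfl hxy
    | simp only [true_and, and_true, true_or, or_true, and_self]
  by_cases hfull : ∃ i, block a u v i ⊆ S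
  · obtain ⟨i, hi⟩ := hfull
    have hA := hU _ (hi ((aux_block_mem a u v i _).2 (Or.inl rfl)))
    have hB := hU _ (hi ((aux_block_mem a u v i _).2 (Or.inr (Or.inl rfl))))
    have h5 : {Sum.inl (a i), Sum.inr (i, false), Sum.inr (i, true), Sum.inl (u i),
      Sum.inl (v i)} ⊆ U := by
      simp only [Finset.insert_subset_iff, Finset.singleton_subset_iff] at hA hB ⊢
      tauto
    by_cases hS3 : S.card ≤ 3
    · have := Finset.eq_of_subset_of_card_le h5 (by rw [hcard5]; omega)
      exact hin i (this ▸ hpU)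
    · have hd : (S \ block a u v i).card = 1 := by
        rw [Finset.card_sdiff_of_subset hi, hcardblock]; omega
      obtain ⟨X, hX⟩ := Finset.card_eq_one.1 hd
      have hXm : X ∈ S \ block a u v i := by simp [hX]
      rw [Finset.mem_sdiff] at hXm
      obtain ⟨hXS, hXn⟩ := hXm
      obtain ⟨j, hj⟩ := (aux_mem_F a u v X).1 (hS hXS)
      have hij : i ≠ j := by rintro rfl; exact hXn hj
      exfalso
      have hXU := hU _ hXS
      -- seven distinct elements are too many
      have seven : ∀ x y, x ≠ y → x ∈ U → y ∈ U →
          x ∉ ({Sum.inl (a i), Sum.inr (i, false), Sum.inr (i, true), Sum.inl (u i),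
            Sum.inl (v i)} : Finset (AssocVert V N)) →
          y ∉ ({Sum.inl (a i), Sum.inr (i, false), Sum.inr (i, true), Sum.inl (u i),
            Sum.inl (v i)} : Finset (AssocVert V N)) → False := by
        intro x y hxy hx hy hx' hy'
        have h7 := Finset.card_le_card
          (Finset.insert_subset hx (Finset.insert_subset hy h5))
        rw [Finset.card_insert_of_notMem (by rw [Finset.mem_insert]; tauto),
          Finset.card_insert_of_notMem hy', hcard5] at h7
        omega
      have key : ∀ t, Sum.inr (j, t) ∈ U → Sum.inl (u j) ∈ U → Sum.inl (v j) ∈ U → False := by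
        intro t hb hu hv
        have e1 : u j = a i ∨ u j = u i ∨ u j = v i := by
          by_contra hcon
          exact seven _ _ (by simp) hb hu (by simp [hij.symm]) (by simpa using hcon)
        have e2 : v j = a i ∨ v j = u i ∨ v j = v i := by
          by_contra hcon
          exact seven _ _ (by simp) hb hv (by simp [hij.symm]) (by simpa using hcon)
        have := huv i j hij
        have t1 := htri i j hij (u i) (Or.inl rfl)
        have t2 := htri i j hij (v i) (Or.inr rfl)
        have := hne j
        grind
      rcases (aux_block_mem a u v j X).1 hj with rfl | rfl | rfl
      · exact seven (Sum.inr (j, false)) (Sum.inr (j, true)) (by simp) (hXU (by simp))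
          (hXU (by simp)) (by simp [hij.symm]) (by simp [hij.symm])
      · exact key false (hXU (by simp)) (hXU (by simp)) (hXU (by simp))
      · exact key true (hXU (by simp)) (hXU (by simp)) (hXU (by simp))
  · push Not at hfull
    have hsum := aux_sum a u v S hS U hU hfull
    have hLR := Finset.card_toLeft_add_card_toRight (u := U)
    have h0 := hsum ∅ (by simp)
    have hL2 : U.toLeft.card ≤ 2 := by simp at h0; omega
    -- type of a touched block
    have htype : ∀ i, ∀ X ∈ S, X ∈ block a u v i → (u i ∈ U.toLeft ∧ v i ∈ U.toLeft ∧
        {Sum.inl (a i), Sum.inr (i, false), Sum.inr (i, true)} ∉ S) ∨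
        (a i ∈ U.toLeft ∧ {Sum.inl (a i), Sum.inr (i, false), Sum.inr (i, true)} ∈ S ∧
        {Sum.inr (i, false), Sum.inl (u i), Sum.inl (v i)} ∉ S ∧
        {Sum.inr (i, true), Sum.inl (u i), Sum.inl (v i)} ∉ S) := by
      intro i X hX hXi
      have h3 : ¬ (a i ∈ U.toLeft ∧ u i ∈ U.toLeft ∧ v i ∈ U.toLeft) := by
        rintro ⟨h1, h2, h3⟩
        have := Finset.card_le_card (show {u i, a i, v i} ⊆ U.toLeft by
          simp only [Finset.insert_subset_iff, Finset.singleton_subset_iff]; tauto)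
        rw [Finset.card_eq_three.2 ⟨u i, a i, v i, (hne i).1, (hne i).2.2, (hne i).2.1, rfl⟩]
          at this
        omega
      have fA : {Sum.inl (a i), Sum.inr (i, false), Sum.inr (i, true)} ∈ S →
          a i ∈ U.toLeft := fun h => by simpa using hU _ h (by simp)
      have fB : {Sum.inr (i, false), Sum.inl (u i), Sum.inl (v i)} ∈ S →
          u i ∈ U.toLeft ∧ v i ∈ U.toLeft :=
        fun h => ⟨by simpa using hU _ h (by simp), by simpa using hU _ h (by simp)⟩
      have fC : {Sum.inr (i, true), Sum.inl (u i), Sum.inl (v i)} ∈ S →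
          u i ∈ U.toLeft ∧ v i ∈ U.toLeft :=
        fun h => ⟨by simpa using hU _ h (by simp), by simpa using hU _ h (by simp)⟩
      rcases (aux_block_mem a u v i X).1 hXi with rfl | rfl | rfl <;> tauto
    have hL1 : ∀ i, ({Sum.inl (a i), Sum.inr (i, false), Sum.inr (i, true)} ∈ S ∧
        {Sum.inr (i, false), Sum.inl (u i), Sum.inl (v i)} ∉ S ∧
        {Sum.inr (i, true), Sum.inl (u i), Sum.inl (v i)} ∉ S) → U.toLeft.card ≤ 1 := by
      intro i hi
      have := hsum {i} (by simpa using hi)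
      simp at this
      omega
    have huv2 : ∀ i, u i ∈ U.toLeft → v i ∈ U.toLeft → {u i, v i} = U.toLeft := by
      intro i h1 h2
      refine Finset.eq_of_subset_of_card_le ?_ (by rw [Finset.card_pair (hne i).2.2]; omega)
      simp only [Finset.insert_subset_iff, Finset.singleton_subset_iff]; tauto
    have hcuv : ∀ i, u i ∈ U.toLeft → v i ∈ U.toLeft → U.toLeft.card = 2 := by
      intro i h1 h2
      rw [← huv2 i h1 h2, Finset.card_pair (hne i).2.2]
    have hsame : ∀ i j, ∀ X ∈ S, ∀ Y ∈ S, X ∈ block a u v i → Y ∈ block a u v j → i = j := by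
      intro i j X hX Y hY hXi hYj
      by_contra hij
      rcases htype i X hX hXi with ⟨h1, h2, -⟩ | ⟨h1, h2⟩ <;>
      rcases htype j Y hY hYj with ⟨g1, g2, -⟩ | ⟨g1, g2⟩
      · have := (huv2 i h1 h2).trans (huv2 j g1 g2).symm
        rw [aux_pair_eq] at this
        exact huv i j hij this
      · have := hL1 j g2
        have := hcuv i h1 h2
        omega
      · have := hL1 i h2
        have := hcuv j g1 g2
        omega
      · have := hsum {i, j} (by
          intro k hk
          simp only [Finset.mem_insert, Finset.mem_singleton] at hk
          rcases hk with rfl | rfl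
          · exact h2
          · exact g2)
        rw [Finset.card_pair hij] at this
        have := Finset.card_pos.2 ⟨_, h1⟩
        omega
    obtain ⟨X, hX⟩ := Finset.card_pos.1 hS1
    obtain ⟨i, hXi⟩ := (aux_mem_F a u v X).1 (hS hX)
    have hSi : S ⊆ block a u v i := by
      intro Y hY
      obtain ⟨j, hYj⟩ := (aux_mem_F a u v Y).1 (hS hY)
      rw [hsame i j X hX Y hY hXi hYj]
      exact hYj
    apply hin i
    refine hpU.trans ?_
    rcases htype i X hX hXi with ⟨h1, h2, h3⟩ | ⟨h1, h2, h3, h4⟩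
    · -- `S` consists of edges through `u, v`
      have huvi := (hne i).2.2
      by_cases hBC : {Sum.inr (i, false), Sum.inl (u i), Sum.inl (v i)} ∈ S ∧
          {Sum.inr (i, true), Sum.inl (u i), Sum.inl (v i)} ∈ S
      · obtain ⟨hB, hC⟩ := hBC
        have hSc : S.card ≤ 2 := by
          refine le_trans (Finset.card_le_card (t :=
            {{Sum.inr (i, false), Sum.inl (u i), Sum.inl (v i)},
            {Sum.inr (i, true), Sum.inl (u i), Sum.inl (v i)}}) ?_) Finset.card_le_two
          intro Y hY
          rcases (aux_block_mem a u v i Y).1 (hSi hY) with rfl | rfl | rfl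
          · exact absurd hY h3
          · simp
          · simp
        have h4 : ({Sum.inr (i, true), Sum.inr (i, false), Sum.inl (u i), Sum.inl (v i)} :
            Finset (AssocVert V N)).card = 4 := by
          rw [Finset.card_insert_of_notMem (by simp),
            Finset.card_insert_of_notMem (by simp), Finset.card_pair (by simpa using huvi)]
        have := Finset.eq_of_subset_of_card_le
          (Finset.insert_subset (hU _ hC (by simp : Sum.inr (i, true) ∈ _)) (hU _ hB))
          (by rw [h4]; omega)
        rw [← this]
        simp [Finset.insert_subset_iff]
      · have hone : S = {X} := by
          refine (Finset.eq_singleton_iff_unique_mem).2 ⟨hX, fun Y hY => ?_⟩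
          rcases (aux_block_mem a u v i Y).1 (hSi hY) with rfl | rfl | rfl <;>
          rcases (aux_block_mem a u v i X).1 (hSi hX) with rfl | rfl | rfl <;> tauto
        have hs := Finset.card_singleton X
        rw [← hone] at hs
        rcases (aux_block_mem a u v i X).1 (hSi hX) with rfl | rfl | rfl
        · exact absurd hX h3
        all_goals
          have := Finset.eq_of_subset_of_card_le (hU _ hX) (by
            rw [Finset.card_eq_three.2
              ⟨_, _, _, (by simp), (by simp), (by simpa using huvi), rfl⟩]; omega)
          rw [← this]
          simp [Finset.insert_subset_iff]
    · have hSe : S = {{Sum.inl (a i), Sum.inr (i, false), Sum.inr (i, true)}} := by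
        apply Finset.Subset.antisymm
        · intro Y hY
          rcases (aux_block_mem a u v i Y).1 (hSi hY) with rfl | rfl | rfl
          · simp
          · exact absurd hY h3
          · exact absurd hY h4
        · simpa using h2
      have hs := Finset.card_singleton
        ({Sum.inl (a i), Sum.inr (i, false), Sum.inr (i, true)} : Finset (AssocVert V N))
      rw [← hSe] at hs
      have := Finset.eq_of_subset_of_card_le (hU _ h2) (by
        rw [Finset.card_eq_three.2 ⟨_, _, _, (by simp), (by simp), (by simp), rfl⟩]; omega)
      rw [← this]
      simp [Finset.insert_subset_iff]

/-- under conditions (iii) and (iv), the number of pairs of distinct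
vertices 1-claimed by the associated 3-graph `F` equals `8N`, and the number of pairs
that are `i`-claimed for some `i ∈ {1,2,3,4}` is at least `8N` and at most `8N` plus the
number of edges of the union graph of the paths. -/
theorem assocF_claimed_pairs {V : Type} (H : SimpleGraph V) (N : ℕ)
    (a u v : Fin N → V)
    (hpath : ∀ i : Fin N, H.Adj (u i) (a i) ∧ H.Adj (a i) (v i) ∧ u i ≠ v i)
    (hdistinct : ∀ i j : Fin N, i ≠ j → pathEdges a u v i ≠ pathEdges a u v j)
    (hiii : ∀ (x : V)
      (w : (SimpleGraph.fromEdgeSet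
        ((((Finset.univ : Finset (Fin N)).sup (pathEdges a u v)) : Finset (Sym2 V)) :
          Set (Sym2 V))).Walk x x),
      w.IsCycle → w.length ≠ 3 ∧ w.length ≠ 4 ∧ w.length ≠ 5)
    (hiv : ∀ j : ℕ, 1 ≤ j → j ≤ 8 → ∀ T : Finset (Fin N), T.card = j →
      j + 2 ≤ (T.sup (pathVerts a u v)).card) :
    Set.ncard {p : Finset (AssocVert V N) | p.card = 2 ∧
        ∃ X ∈ assocF a u v, p ⊆ X} = 8 * N ∧
      8 * N ≤ Set.ncard {p : Finset (AssocVert V N) | p.card = 2 ∧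
          ∃ i : ℕ, 1 ≤ i ∧ i ≤ 4 ∧ ∃ S ⊆ assocF a u v, S.card = i ∧
            (p ∪ S.sup id).card ≤ i + 2} ∧
      Set.ncard {p : Finset (AssocVert V N) | p.card = 2 ∧
          ∃ i : ℕ, 1 ≤ i ∧ i ≤ 4 ∧ ∃ S ⊆ assocF a u v, S.card = i ∧
            (p ∪ S.sup id).card ≤ i + 2} ≤
        8 * N + ((Finset.univ : Finset (Fin N)).sup (pathEdges a u v)).card := by
  have hne : ∀ i, u i ≠ a i ∧ a i ≠ v i ∧ u i ≠ v i := fun i =>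
    ⟨(hpath i).1.ne, (hpath i).2.1.ne, (hpath i).2.2⟩
  have hE1 : ∀ i, s(u i, a i) ∈ (((Finset.univ : Finset (Fin N)).sup (pathEdges a u v) :
      Finset (Sym2 V)) : Set (Sym2 V)) := fun i =>
    Finset.mem_coe.2 ((aux_mem_E a u v _).2 ⟨i, Or.inl rfl⟩)
  have hE2 : ∀ i, s(a i, v i) ∈ (((Finset.univ : Finset (Fin N)).sup (pathEdges a u v) :
      Finset (Sym2 V)) : Set (Sym2 V)) := fun i =>
    Finset.mem_coe.2 ((aux_mem_E a u v _).2 ⟨i, Or.inr rfl⟩)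
  have hE1' : ∀ i, s(a i, u i) ∈ (((Finset.univ : Finset (Fin N)).sup (pathEdges a u v) :
      Finset (Sym2 V)) : Set (Sym2 V)) := fun i => Sym2.eq_swap ▸ hE1 i
  have hE2' : ∀ i, s(v i, a i) ∈ (((Finset.univ : Finset (Fin N)).sup (pathEdges a u v) :
      Finset (Sym2 V)) : Set (Sym2 V)) := fun i => Sym2.eq_swap ▸ hE2 i
  have huv : ∀ i j, i ≠ j → ¬ ((u i = u j ∧ v i = v j) ∨ (u i = v j ∧ v i = u j)) := by
    intro i j hij h
    obtain ⟨n1, n2, n3⟩ := hne i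
    obtain ⟨m1, m2, m3⟩ := hne j
    by_cases haa : a i = a j
    · apply hdistinct i j hij
      unfold pathEdges
      rcases h with ⟨h1, h2⟩ | ⟨h1, h2⟩
      · rw [h1, h2, haa]
      · rw [h1, h2, haa, Finset.pair_comm, Sym2.eq_swap (a := a j) (b := u j),
          Sym2.eq_swap (a := a j) (b := v j)]
    · rcases h with ⟨h1, h2⟩ | ⟨h1, h2⟩
      · exact aux_quad _ hiii (u i) (a i) (v i) (a j) (hE1 i) (hE2 i) (h2 ▸ hE2' j)
          (h1 ▸ hE1' j) n1 n2 (h2 ▸ m2.symm) (h1 ▸ m1.symm) n3 haa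
      · exact aux_quad _ hiii (u i) (a i) (v i) (a j) (hE1 i) (hE2 i) (h2 ▸ hE1 j)
          (h1 ▸ hE2 j) n1 n2 (h2 ▸ m1) (h1 ▸ m2) n3 haa
  have htri : ∀ i j, i ≠ j → ∀ x, (x = u i ∨ x = v i) →
      ¬ ((u j = a i ∧ v j = x) ∨ (v j = a i ∧ u j = x)) := by
    intro i j hij x hx h
    obtain ⟨m1, m2, m3⟩ := hne j
    have hxa : s(x, a i) ∈ (((Finset.univ : Finset (Fin N)).sup (pathEdges a u v) :
        Finset (Sym2 V)) : Set (Sym2 V)) := by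
      rcases hx with rfl | rfl
      · exact hE1 i
      · exact hE2' i
    rcases h with ⟨h1, rfl⟩ | ⟨h1, rfl⟩
    · rw [← h1] at hxa
      exact aux_tri _ hiii (u j) (a j) (v j) (hE1 j) (hE2 j) hxa m1 m2 m3.symm
    · rw [← h1] at hxa
      exact aux_tri _ hiii (v j) (a j) (u j) (hE2' j) (hE1' j) hxa m2.symm m1.symm m3
  have hset1 : {p : Finset (AssocVert V N) | p.card = 2 ∧ ∃ X ∈ assocF a u v, p ⊆ X} =
      (((Finset.univ : Finset (Fin N)).biUnion (auxC a u v) :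
        Finset (Finset (AssocVert V N))) : Set (Finset (AssocVert V N))) := by
    ext p
    simp only [Set.mem_ofPred_eq, Finset.mem_coe, Finset.mem_biUnion, Finset.mem_univ, true_and,
      aux_mem_F]
    constructor
    · rintro ⟨h, X, ⟨i, hi⟩, hX⟩
      exact ⟨i, (aux_C_mem a u v i (hne i).2.2 p).2 ⟨h, X, hi, hX⟩⟩
    · rintro ⟨i, hi⟩
      obtain ⟨h, X, hX, hpX⟩ := (aux_C_mem a u v i (hne i).2.2 p).1 hi
      exact ⟨h, X, ⟨i, hX⟩, hpX⟩
  have hcard1 : ((Finset.univ : Finset (Fin N)).biUnion (auxC a u v)).card = 8 * N := by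
    rw [Finset.card_biUnion (fun i _ j _ hij => aux_C_disj a u v i j hij (huv i j hij))]
    rw [Finset.sum_congr rfl (fun i _ => show (auxC a u v i).card = 8 from
      aux_pairs_card _ _ _ _ _ (by simp) (by simp) (by simpa using (hne i).1.symm)
        (by simpa using (hne i).2.1) (by simp) (by simp) (by simp) (by simp) (by simp)
        (by simpa using (hne i).2.2))]
    simp [mul_comm]
  set E := (Finset.univ : Finset (Fin N)).sup (pathEdges a u v) with hEdef
  let f : Sym2 V → Finset (AssocVert V N) := fun e => (e.map Sum.inl).toFinset
  have hsub : {p : Finset (AssocVert V N) | p.card = 2 ∧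
          ∃ i : ℕ, 1 ≤ i ∧ i ≤ 4 ∧ ∃ S ⊆ assocF a u v, S.card = i ∧
            (p ∪ S.sup id).card ≤ i + 2} ⊆
      (((Finset.univ : Finset (Fin N)).biUnion (auxC a u v) ∪ E.image f :
        Finset (Finset (AssocVert V N))) : Set (Finset (AssocVert V N))) := by
    rintro p ⟨hp, i, hi1, hi4, S, hS, rfl, hc⟩
    rw [Finset.mem_coe, Finset.mem_union]
    rcases aux_key a u v hne huv htri S hS hi1 hi4 p hp hc with ⟨i, h⟩ | ⟨i, h⟩
    · left
      exact Finset.mem_biUnion.2 ⟨i, Finset.mem_univ _, h⟩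
    · right
      rcases h with rfl | rfl
      · refine Finset.mem_image.2 ⟨_, hE1 i, ?_⟩
        ext z
        simp [f]
      · refine Finset.mem_image.2 ⟨_, hE2 i, ?_⟩
        ext z
        simp [f]
  have hfin := (Finset.finite_toSet _).subset hsub
  refine ⟨?_, ?_, ?_⟩
  · rw [hset1, Set.ncard_coe_finset, hcard1]
  · rw [← hcard1, ← Set.ncard_coe_finset, ← hset1]
    refine Set.ncard_le_ncard ?_ hfin
    rintro p ⟨hp, X, hX, hpX⟩
    refine ⟨hp, 1, le_rfl, by norm_num, {X}, by simpa using hX, by simp, ?_⟩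
    rw [Finset.sup_singleton, id, Finset.union_eq_right.2 hpX]
    obtain ⟨i, hi⟩ := (aux_mem_F a u v X).1 hX
    rcases (aux_block_mem a u v i X).1 hi with rfl | rfl | rfl <;> exact Finset.card_le_three
  · refine le_trans (Set.ncard_le_ncard hsub (Finset.finite_toSet _)) ?_
    rw [Set.ncard_coe_finset]
    refine le_trans (Finset.card_union_le _ _) ?_
    rw [hcard1]
    exact Nat.add_le_add_left Finset.card_image_le _
end

section
/- Let H be a graph and P_1,…,P_N distinct 2-paths of H, where P_i has internal vertex a_i and endpoints u_i, v_i, satisfying conditions (iii) and (iv): the union graph of P_1,…,P_N contains no cycle of length 3, 4 or 5, and for every j ∈ {1,…,8} the union of the vertex sets of any j distinct paths has at least j+2 elements. Let F be the associated 3-graph built from P_1,…,P_N. Let 3 ≤ k ≤ 8 and let S be a set of k distinct edges of F whose union has at most k+2 vertices. Let I be the set of indices i ∈ {1,…,N} such that all three edges of the block R_i belong to S. Then (A) I is nonempty, and (B) the union of the blocks R_i over i ∈ I consists of 3|I| distinct edges whose union has at most 3|I|+2 vertices. -/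
open scoped Classical

section helpers

variable {V : Type} {N : ℕ}

/-- The edge `{aᵢ,bᵢ,cᵢ}`. -/
noncomputable def eA (a : Fin N → V) (i : Fin N) : Finset (AssocVert V N) :=
  {Sum.inl (a i), Sum.inr (i, false), Sum.inr (i, true)}

/-- The edge `{bᵢ,uᵢ,vᵢ}` or `{cᵢ,uᵢ,vᵢ}`. -/
noncomputable def eB (u v : Fin N → V) (i : Fin N) (t : Bool) : Finset (AssocVert V N) :=
  {Sum.inr (i, t), Sum.inl (u i), Sum.inl (v i)}

lemma mem_block (a u v : Fin N → V) (i : Fin N) (e : Finset (AssocVert V N)) :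
    e ∈ block a u v i ↔ e = eA a i ∨ e = eB u v i false ∨ e = eB u v i true := by
  simp [block, eA, eB]

lemma block_card (a u v : Fin N → V) (i : Fin N) : (block a u v i).card = 3 := by
  have h1 : eA a i ≠ eB u v i false := by
    intro h
    have : (Sum.inr (i, true) : AssocVert V N) ∈ eB u v i false := by rw [← h]; simp [eA]
    simp [eB] at this
  have h2 : eA a i ≠ eB u v i true := by
    intro h
    have : (Sum.inr (i, false) : AssocVert V N) ∈ eB u v i true := by rw [← h]; simp [eA]
    simp [eB] at this
  have h3 : eB u v i false ≠ eB u v i true := by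
    intro h
    have : (Sum.inr (i, false) : AssocVert V N) ∈ eB u v i true := by rw [← h]; simp [eB]
    simp [eB] at this
  have : block a u v i = {eA a i, eB u v i false, eB u v i true} := rfl
  rw [this, Finset.card_eq_three]
  exact ⟨_, _, _, h1, h2, h3, rfl⟩

lemma idx_of_mem_block (a u v : Fin N → V) (i : Fin N) (e : Finset (AssocVert V N))
    (he : e ∈ block a u v i) :
    (∃ t, (Sum.inr (i, t) : AssocVert V N) ∈ e) ∧
      ∀ j t, (Sum.inr (j, t) : AssocVert V N) ∈ e → j = i := by
  rw [mem_block] at he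
  rcases he with rfl | rfl | rfl
  · refine ⟨⟨true, by simp [eA]⟩, fun j t h => ?_⟩
    simp [eA] at h; tauto
  · refine ⟨⟨false, by simp [eB]⟩, fun j t h => ?_⟩
    simp [eB] at h; tauto
  · refine ⟨⟨true, by simp [eB]⟩, fun j t h => ?_⟩
    simp [eB] at h; tauto

lemma block_disj (a u v : Fin N → V) (i j : Fin N) (hij : i ≠ j) :
    Disjoint (block a u v i) (block a u v j) := by
  rw [Finset.disjoint_left]
  intro e hi hj
  obtain ⟨⟨t, ht⟩, _⟩ := idx_of_mem_block a u v i e hi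
  exact hij ((idx_of_mem_block a u v j e hj).2 i t ht)

/-- Two distinct paths with the same endpoints give a 4-cycle. -/
lemma no_same_ends (H : SimpleGraph V) (a u v : Fin N → V)
    (hpath : ∀ i : Fin N, H.Adj (u i) (a i) ∧ H.Adj (a i) (v i) ∧ u i ≠ v i)
    (hdistinct : ∀ i j : Fin N, i ≠ j → pathEdges a u v i ≠ pathEdges a u v j)
    (hiii : ∀ (x : V)
      (w : (SimpleGraph.fromEdgeSet
        ((((Finset.univ : Finset (Fin N)).sup (pathEdges a u v)) : Finset (Sym2 V)) :
          Set (Sym2 V))).Walk x x),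
      w.IsCycle → w.length ≠ 3 ∧ w.length ≠ 4 ∧ w.length ≠ 5)
    (i j : Fin N) (hij : i ≠ j)
    (h : (u j = u i ∧ v j = v i) ∨ (u j = v i ∧ v j = u i)) : False := by
  have hne : a i ≠ a j := by
    intro hae
    apply hdistinct i j hij
    rcases h with ⟨h1, h2⟩ | ⟨h1, h2⟩
    · simp [pathEdges, h1, h2, hae]
    · simp only [pathEdges, h1, h2, hae]
      rw [Finset.pair_comm, Sym2.eq_swap (a := u i), Sym2.eq_swap (a := a j) (b := v i)]
  have hi1 := (hpath i).1.ne
  have hi2 := (hpath i).2.1.ne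
  have hi3 := (hpath i).2.2
  have hj1 := (hpath j).1.ne
  have hj2 := (hpath j).2.1.ne
  have key : ∀ l : Fin N, s(u l, a l) ∈ (Finset.univ : Finset (Fin N)).sup (pathEdges a u v) ∧
      s(a l, v l) ∈ (Finset.univ : Finset (Fin N)).sup (pathEdges a u v) := by
    intro l
    simp only [Finset.mem_sup]
    exact ⟨⟨l, by simp, by simp [pathEdges]⟩, ⟨l, by simp, by simp [pathEdges]⟩⟩
  generalize (Finset.univ : Finset (Fin N)).sup (pathEdges a u v) = E at hiii key
  let G := SimpleGraph.fromEdgeSet (E : Set (Sym2 V))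
  have adj : ∀ x y, s(x, y) ∈ E → x ≠ y → G.Adj x y := by
    intro x y h1 h2
    exact (SimpleGraph.fromEdgeSet_adj _).2 ⟨h1, h2⟩
  have g1 : G.Adj (u i) (a i) := adj _ _ (key i).1 hi1
  have g2 : G.Adj (a i) (v i) := adj _ _ (key i).2 hi2
  have q1 : G.Adj (u j) (a j) := adj _ _ (key j).1 hj1
  have q2 : G.Adj (a j) (v j) := adj _ _ (key j).2 hj2
  have g3 : G.Adj (v i) (a j) := by
    rcases h with ⟨h1, h2⟩ | ⟨h1, h2⟩
    · rw [← h2]; exact q2.symm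
    · rw [← h1]; exact q1
  have g4 : G.Adj (a j) (u i) := by
    rcases h with ⟨h1, h2⟩ | ⟨h1, h2⟩
    · rw [← h1]; exact q1.symm
    · rw [← h2]; exact q2
  have n3 := g3.ne
  have n4 := g4.ne
  let w : G.Walk (u i) (u i) := .cons g1 (.cons g2 (.cons g3 (.cons g4 .nil)))
  have hw : w.IsCycle := by
    simp only [w, SimpleGraph.Walk.cons_isCycle_iff]
    simp
    grind
  exact (hiii _ w hw).2.1 rfl

lemma count_aux_s11 (A B C p q r : Prop) [Decidable A] [Decidable B] [Decidable C] [Decidable p]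
    [Decidable q] [Decidable r] (e : ℕ)
    (h0 : e ≤ (if A then 1 else 0) + (if B then 1 else 0) + (if C then 1 else 0))
    (h1 : A → p) (h2 : A → q) (h3 : C → p) (h4 : B → q) (h5 : A → B → C → r) :
    e ≤ ((if p then 1 else 0) + (if q then 1 else 0)) + (if r then 1 else 0) := by
  by_cases hA : A <;> by_cases hB : B <;> by_cases hC : C <;> simp_all <;> omega

end helpers

/-- under conditions (iii) and (iv), if `S` is a set of `k` distinct edges
(`3 ≤ k ≤ 8`) of the associated 3-graph `F` spanning at most `k+2` vertices, and `I` is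
the set of indices whose whole block lies in `S`, then `I` is nonempty and the union of
the blocks over `I` consists of `3|I|` distinct edges spanning at most `3|I|+2`
vertices. -/
theorem assocF_full_blocks {V : Type} (H : SimpleGraph V) (N : ℕ)
    (a u v : Fin N → V)
    (hpath : ∀ i : Fin N, H.Adj (u i) (a i) ∧ H.Adj (a i) (v i) ∧ u i ≠ v i)
    (hdistinct : ∀ i j : Fin N, i ≠ j → pathEdges a u v i ≠ pathEdges a u v j)
    (hiii : ∀ (x : V)
      (w : (SimpleGraph.fromEdgeSet
        ((((Finset.univ : Finset (Fin N)).sup (pathEdges a u v)) : Finset (Sym2 V)) :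
          Set (Sym2 V))).Walk x x),
      w.IsCycle → w.length ≠ 3 ∧ w.length ≠ 4 ∧ w.length ≠ 5)
    (hiv : ∀ j : ℕ, 1 ≤ j → j ≤ 8 → ∀ T : Finset (Fin N), T.card = j →
      j + 2 ≤ (T.sup (pathVerts a u v)).card)
    (k : ℕ) (hk3 : 3 ≤ k) (hk8 : k ≤ 8)
    (S : Finset (Finset (AssocVert V N))) (hSF : S ⊆ assocF a u v)
    (hScard : S.card = k) (hSverts : (S.sup id).card ≤ k + 2) :
    ((Finset.univ : Finset (Fin N)).filter (fun i => block a u v i ⊆ S)).Nonempty ∧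
      ((((Finset.univ : Finset (Fin N)).filter (fun i => block a u v i ⊆ S)).sup
          (block a u v)).card =
        3 * ((Finset.univ : Finset (Fin N)).filter (fun i => block a u v i ⊆ S)).card) ∧
      (((((Finset.univ : Finset (Fin N)).filter (fun i => block a u v i ⊆ S)).sup
          (block a u v)).sup id).card ≤
        3 * ((Finset.univ : Finset (Fin N)).filter (fun i => block a u v i ⊆ S)).card
          + 2) := by
  set U := S.sup id with hU
  have memU : ∀ x e, e ∈ S → x ∈ e → x ∈ U := by
    intro x e h1 h2
    exact Finset.mem_sup.2 ⟨e, h1, h2⟩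
  set I := (Finset.univ : Finset (Fin N)).filter (fun i => block a u v i ⊆ S) with hI
  have hmemI : ∀ i, eA a i ∈ S → eB u v i false ∈ S → eB u v i true ∈ S → i ∈ I := by
    intro i h1 h2 h3
    rw [hI, Finset.mem_filter]
    refine ⟨Finset.mem_univ _, fun e he => ?_⟩
    rw [mem_block] at he
    rcases he with rfl | rfl | rfl <;> assumption
  -- number of edges and of new vertices at an index
  let n : Fin N → ℕ := fun i => (if (Sum.inr (i, true) : AssocVert V N) ∈ U then 1 else 0) +
    (if (Sum.inr (i, false) : AssocVert V N) ∈ U then 1 else 0)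
  let e : Fin N → ℕ := fun i => (S ∩ block a u v i).card
  have hn : U.toRight.card = ∑ i, n i := by
    rw [← Finset.filter_univ_mem U.toRight, Finset.card_filter, Fintype.sum_prod_type]
    simp only [Fintype.sum_bool, Finset.mem_toRight, n]
  have hcU : U.toLeft.card + U.toRight.card = U.card := Finset.card_toLeft_add_card_toRight
  have hS : S.card ≤ ∑ i, e i := by
    calc S.card ≤ (Finset.univ.biUnion (fun i => S ∩ block a u v i)).card := by
          apply Finset.card_le_card
          intro x hx
          obtain ⟨i, _, hi⟩ := Finset.mem_sup.1 (hSF hx)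
          exact Finset.mem_biUnion.2 ⟨i, Finset.mem_univ _, Finset.mem_inter.2 ⟨hx, hi⟩⟩
      _ ≤ _ := Finset.card_biUnion_le
  have he : ∀ i, e i ≤ (if eA a i ∈ S then 1 else 0) + (if eB u v i false ∈ S then 1 else 0) +
      (if eB u v i true ∈ S then 1 else 0) := by
    intro i
    have : e i ≤ ((((({eA a i} : Finset _).filter (· ∈ S))) ∪
        (({eB u v i false} : Finset _).filter (· ∈ S))) ∪
        (({eB u v i true} : Finset _).filter (· ∈ S))).card := by
      apply Finset.card_le_card
      intro x hx
      rw [Finset.mem_inter, mem_block] at hx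
      simp only [Finset.mem_union, Finset.mem_filter, Finset.mem_singleton]
      tauto
    refine this.trans ((Finset.card_union_le _ _).trans
      (Nat.add_le_add ((Finset.card_union_le _ _).trans (Nat.add_le_add ?_ ?_)) ?_)) <;>
    · rw [Finset.card_filter, Finset.sum_singleton]
  have hA1 : ∀ i t, eA a i ∈ S → (Sum.inr (i, t) : AssocVert V N) ∈ U := by
    intro i t h
    refine memU _ _ h ?_
    cases t <;> simp [eA]
  have hA2 : ∀ i, eA a i ∈ S → a i ∈ U.toLeft := by
    intro i h
    rw [Finset.mem_toLeft]
    exact memU _ _ h (by simp [eA])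
  have hB1 : ∀ i t, eB u v i t ∈ S → (Sum.inr (i, t) : AssocVert V N) ∈ U := by
    intro i t h
    exact memU _ _ h (by simp [eB])
  have hB2 : ∀ i t, eB u v i t ∈ S → u i ∈ U.toLeft ∧ v i ∈ U.toLeft := by
    intro i t h
    simp only [Finset.mem_toLeft]
    exact ⟨memU _ _ h (by simp [eB]), memU _ _ h (by simp [eB])⟩
  have hle : ∀ i, e i ≤ n i + (if i ∈ I then 1 else 0) := by
    intro i
    exact count_aux_s11 _ _ _ _ _ _ _ (he i) (hA1 i true) (hA1 i false) (hB1 i true) (hB1 i false)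
      (hmemI i)
  have hlt : ∀ i, eA a i ∈ S → eB u v i false ∉ S → eB u v i true ∉ S → e i + 1 ≤ n i := by
    intro i g1 g2 g3
    have h0 := he i
    have h1 := hA1 i true g1
    have h2 := hA1 i false g1
    simp only [n, g1, g2, g3, h1, h2, if_true, if_false] at h0 ⊢
    omega
  have hsumI : ∑ i, (if i ∈ I then 1 else 0) = I.card := by simp
  have hold : U.toLeft.card ≤ I.card + 2 := by
    have := Finset.sum_le_sum (fun i (_ : i ∈ Finset.univ) => hle i)
    rw [Finset.sum_add_distrib, hsumI] at this
    omega
  refine ⟨?_, ?_, ?_⟩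
  · by_contra hemp
    rw [Finset.not_nonempty_iff_eq_empty] at hemp
    rw [hemp] at hold hle
    simp only [Finset.card_empty, Finset.notMem_empty, if_false] at hold hle
    by_cases hex : ∃ j, eA a j ∈ S
    · obtain ⟨j, hj⟩ := hex
      have hnb : ∀ t, eB u v j t ∉ S := by
        intro t ht
        have hsub : ({u j, a j, v j} : Finset V) ⊆ U.toLeft := by
          intro x hx
          simp only [Finset.mem_insert, Finset.mem_singleton] at hx
          rcases hx with rfl | rfl | rfl
          · exact (hB2 j t ht).1
          · exact hA2 j hj
          · exact (hB2 j t ht).2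
        have h3 : ({u j, a j, v j} : Finset V).card = 3 :=
          Finset.card_eq_three.2 ⟨_, _, _, (hpath j).1.ne, (hpath j).2.2, (hpath j).2.1.ne, rfl⟩
        have := Finset.card_le_card hsub
        omega
      have hs : ∑ i, e i < ∑ i, n i :=
        Finset.sum_lt_sum (fun i _ => hle i) ⟨j, Finset.mem_univ _, hlt j hj (hnb _) (hnb _)⟩
      have hnB : ∀ i t, eB u v i t ∉ S := by
        intro i t ht
        have hsub : ({u i, v i} : Finset V) ⊆ U.toLeft := by
          intro x hx
          simp only [Finset.mem_insert, Finset.mem_singleton] at hx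
          rcases hx with rfl | rfl
          · exact (hB2 i t ht).1
          · exact (hB2 i t ht).2
        have h3 := Finset.card_pair (hpath i).2.2
        have := Finset.card_le_card hsub
        omega
      have h2 : ∑ i, 2 * e i ≤ ∑ i, n i := by
        apply Finset.sum_le_sum
        intro i _
        have h0 := he i
        simp only [hnB, if_false] at h0
        by_cases hi : eA a i ∈ S
        · have := hlt i hi (hnB _ _) (hnB _ _)
          simp only [hi, if_true] at h0
          omega
        · simp only [hi, if_false] at h0
          omega
      rw [← Finset.mul_sum] at h2
      omega
    · push Not at hex
      have hform : ∀ x ∈ S, ∃ i t, x = eB u v i t := by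
        intro x hx
        obtain ⟨i, _, hi⟩ := Finset.mem_sup.1 (hSF hx)
        rw [mem_block] at hi
        rcases hi with rfl | rfl | rfl
        · exact absurd hx (hex i)
        · exact ⟨_, _, rfl⟩
        · exact ⟨_, _, rfl⟩
      obtain ⟨x, hx⟩ : S.Nonempty := Finset.card_pos.1 (by omega)
      obtain ⟨i, t, rfl⟩ := hform x hx
      have hother : ∃ y ∈ S, y ∉ ({eB u v i false, eB u v i true} : Finset _) := by
        by_contra hcon
        push Not at hcon
        have h1 := Finset.card_le_card (show S ⊆ _ from hcon)
        have h2 := Finset.card_le_two (a := eB u v i false) (b := eB u v i true)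
        omega
      obtain ⟨y, hy, hyn⟩ := hother
      obtain ⟨j, s, rfl⟩ := hform y hy
      have hij : i ≠ j := by
        rintro rfl
        apply hyn
        cases s <;> simp
      have hsub : ({u i, v i} : Finset V) ⊆ U.toLeft := by
        intro x hx
        simp only [Finset.mem_insert, Finset.mem_singleton] at hx
        rcases hx with rfl | rfl
        · exact (hB2 i t ‹_›).1
        · exact (hB2 i t ‹_›).2
      have heq : ({u i, v i} : Finset V) = U.toLeft :=
        Finset.eq_of_subset_of_card_le hsub (by rw [Finset.card_pair (hpath i).2.2]; omega)
      obtain ⟨m1, m2⟩ := hB2 j s hy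
      rw [← heq] at m1 m2
      simp only [Finset.mem_insert, Finset.mem_singleton] at m1 m2
      have hne := (hpath j).2.2
      apply no_same_ends H a u v hpath hdistinct hiii i j hij
      rcases m1 with m1 | m1 <;> rcases m2 with m2 | m2
      · exact absurd (m1.trans m2.symm) hne
      · exact Or.inl ⟨m1, m2⟩
      · exact Or.inr ⟨m1, m2⟩
      · exact absurd (m1.trans m2.symm) hne
  · rw [Finset.sup_eq_biUnion, Finset.card_biUnion (fun i _ j _ hij => block_disj a u v i j hij)]
    simp only [block_card, Finset.sum_const, smul_eq_mul]
    omega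
  · set W := (I.sup (block a u v)).sup id with hW
    have hWm : ∀ x ∈ W, ∃ i ∈ I, ∃ f ∈ block a u v i, x ∈ f := by
      intro x hx
      obtain ⟨f, hf, hxf⟩ := Finset.mem_sup.1 hx
      obtain ⟨i, hi, hif⟩ := Finset.mem_sup.1 hf
      exact ⟨i, hi, f, hif, hxf⟩
    have h1 : W.toLeft ⊆ U.toLeft := by
      intro x hx
      rw [Finset.mem_toLeft] at hx ⊢
      obtain ⟨i, hi, f, hif, hxf⟩ := hWm _ hx
      exact memU _ f ((Finset.mem_filter.1 hi).2 hif) hxf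
    have h2 : W.toRight ⊆ I ×ˢ (Finset.univ : Finset Bool) := by
      rintro ⟨j, t⟩ hx
      rw [Finset.mem_toRight] at hx
      obtain ⟨i, hi, f, hif, hxf⟩ := hWm _ hx
      have := (idx_of_mem_block a u v i f hif).2 j t hxf
      subst this
      simp [hi]
    have c1 := Finset.card_le_card h1
    have c2 := Finset.card_le_card h2
    rw [Finset.card_product, Finset.card_univ, Fintype.card_bool] at c2
    have hcW : W.toLeft.card + W.toRight.card = W.card := Finset.card_toLeft_add_card_toRight
    omega
end
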